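/- Suppose a < 0 and a + b ≤ 0. Then, almost surely, limsup_{t→∞} X(t)/√(2 log t) = σ/√(2|a|) and liminf_{t→∞} X(t)/√(2 log t) = −σ/√(2|a|). -/

import Mathlib

open MeasureTheory ProbabilityTheory Filter Real Set

noncomputable section

/-- `B` is a standard one-dimensional Brownian motion adapted to the filtration `F`
under the probability measure `P`: all paths are continuous and start at `0`, the
increment `B t - B s` is Gaussian with mean `0` and variance `t - s`, and increments
after time `s` are independent of `F s`. -/
def IsStdBrownian {Ω : Type*} {mΩ : MeasurableSpace Ω} (P : Measure Ω)
    (F : MeasureTheory.Filtration ℝ mΩ) (B : ℝ → Ω → ℝ) : Prop :=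
  MeasureTheory.Adapted F B ∧
  (∀ ω, B 0 ω = 0) ∧
  (∀ ω, Continuous fun t => B t ω) ∧
  (∀ s t : ℝ, 0 ≤ s → s ≤ t →
    P.map (fun ω => B t ω - B s ω) = gaussianReal 0 (Real.toNNReal (t - s))) ∧
  (∀ s t : ℝ, 0 ≤ s → s ≤ t →
    Indep (MeasurableSpace.comap (fun ω => B t ω - B s ω) Real.measurableSpace) (F s) P)

/-- `X` is the (continuous, adapted) solution of the affine stochastic functional
differential equation `dX(t) = (a X(t) + b/(1+t) ∫_{-1}^t X(s) ds) dt + σ dB(t)` for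
`t ≥ 0`, with initial history `ψ` on `[-1, 0]`; i.e. almost surely, for all `t ≥ 0`,
`X t = ψ 0 + ∫_0^t (a X(s) + b/(1+s) (∫_{-1}^0 ψ(u) du + ∫_0^s X(u) du)) ds + σ B t`. -/
def IsSolutionSFDE {Ω : Type*} {mΩ : MeasurableSpace Ω} (P : Measure Ω)
    (F : MeasureTheory.Filtration ℝ mΩ) (a b σ : ℝ) (ψ : ℝ → ℝ)
    (B X : ℝ → Ω → ℝ) : Prop :=
  (∀ t : ℝ, 0 ≤ t → StronglyMeasurable[F t] (X t)) ∧
  (∀ ω, ContinuousOn (fun t => X t ω) (Set.Ici (0 : ℝ))) ∧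
  (∀ᵐ ω ∂P, ∀ t : ℝ, 0 ≤ t →
    X t ω = ψ 0
      + (∫ s in (0:ℝ)..t,
          (a * X s ω + b / (1 + s) * ((∫ u in (-1:ℝ)..(0:ℝ), ψ u) + ∫ u in (0:ℝ)..s, X u ω)))
      + σ * B t ω)

/-- A function whose derivative pushes it back towards the origin stays bounded. -/
theorem bounded_of_dissipative {u u' : ℝ → ℝ} {α K T : ℝ} (hα : 0 < α)
    (hu : ∀ t ≥ T, HasDerivAt u (u' t) t)
    (hdis : ∀ t ≥ T, u t * u' t ≤ -α * u t ^ 2 + K * |u t|) :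
    ∃ C, ∀ t ≥ T, |u t| ≤ C := by
  have hderiv : ∀ t ≥ T, HasDerivAt (fun t => exp (α * t) * (u t ^ 2 - K ^ 2 / α ^ 2))
      (exp (α * t) * (α * (u t ^ 2 - K ^ 2 / α ^ 2) + 2 * (u t * u' t))) t := by
    intro t ht
    have h1 : HasDerivAt (fun t => exp (α * t)) (exp (α * t) * (α * 1)) t :=
      ((hasDerivAt_id t).const_mul α).exp
    have h2 := ((hu t ht).pow 2).sub_const (K ^ 2 / α ^ 2)
    refine (h1.mul h2).congr_deriv ?_
    push_cast
    simp
    ring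
  have hanti : AntitoneOn (fun t => exp (α * t) * (u t ^ 2 - K ^ 2 / α ^ 2)) (Ici T) := by
    refine antitoneOn_of_hasDerivWithinAt_nonpos (convex_Ici T)
      (fun t ht => (hderiv t ht).continuousAt.continuousWithinAt)
      (fun t ht => (hderiv t (interior_subset ht)).hasDerivWithinAt) (fun t ht => ?_)
    refine mul_nonpos_of_nonneg_of_nonpos (exp_pos _).le ?_
    have h := hdis t (interior_subset ht)
    have hsq : 0 ≤ (α * |u t| - K) ^ 2 / α := by positivity
    have he : (α * |u t| - K) ^ 2 / α = α * u t ^ 2 - 2 * K * |u t| + K ^ 2 / α := by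
      rw [← sq_abs (u t)]
      field_simp
      ring
    have he2 : α * (u t ^ 2 - K ^ 2 / α ^ 2) = α * u t ^ 2 - K ^ 2 / α := by
      field_simp
    rw [he2]
    linarith
  refine ⟨√(u T ^ 2 + K ^ 2 / α ^ 2), fun t ht => abs_le_sqrt ?_⟩
  have h := hanti (mem_Ici.2 le_rfl) (mem_Ici.2 ht) ht
  have hK : 0 ≤ K ^ 2 / α ^ 2 := by positivity
  simp only at h
  by_contra! hc
  have hexp : exp (α * T) ≤ exp (α * t) := exp_le_exp.2 (mul_le_mul_of_nonneg_left ht hα.le)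
  have hpos := exp_pos (α * T)
  nlinarith [sq_nonneg (u T)]

/-- A nonnegative function with an integrable relative growth rate is bounded. -/
theorem bounded_of_deriv_le_rpow {E E' : ℝ → ℝ} {C T : ℝ} (hT : 0 ≤ T)
    (hE : ∀ t ≥ T, HasDerivAt E (E' t) t) 
    (hle : ∀ t ≥ T, E' t ≤ C * (1 + t) ^ (-(5 / 4) : ℝ) * (E t + 1)) (hC : 0 ≤ C) (hE0 : ∀ t ≥ T, 0 ≤ E t) :
    ∃ D, ∀ t ≥ T, E t ≤ D := by
  set G : ℝ → ℝ := fun t => exp (4 * C * (1 + t) ^ (-(1 / 4) : ℝ)) with hG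
  have hderiv : ∀ t ≥ T, HasDerivAt (fun t => G t * (E t + 1))
      (G t * (E' t - C * (1 + t) ^ (-(5 / 4) : ℝ) * (E t + 1))) t := by
    intro t ht
    have h0 : HasDerivAt (fun t : ℝ => 1 + t) 1 t := (hasDerivAt_id t).const_add 1
    have h1 := ((h0.rpow_const (p := (-(1 / 4) : ℝ)) (Or.inl (by linarith))).const_mul (4 * C)).exp
    refine (h1.mul ((hE t ht).add_const 1)).congr_deriv ?_
    rw [show (-(1 / 4) - 1 : ℝ) = -(5 / 4) by norm_num]
    simp only [hG]
    ring
  have hanti : AntitoneOn (fun t => G t * (E t + 1)) (Ici T) := by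
    refine antitoneOn_of_hasDerivWithinAt_nonpos (convex_Ici T)
      (fun t ht => (hderiv t ht).continuousAt.continuousWithinAt)
      (fun t ht => (hderiv t (interior_subset ht)).hasDerivWithinAt) (fun t ht => ?_)
    refine mul_nonpos_of_nonneg_of_nonpos (exp_pos _).le ?_
    linarith [hle t (interior_subset ht)]
  refine ⟨G T * (E T + 1), fun t ht => ?_⟩
  have h := hanti (mem_Ici.2 le_rfl) (mem_Ici.2 ht) ht
  simp only at h
  have h1 : 1 ≤ G t := one_le_exp (mul_nonneg (by linarith) (rpow_nonneg (by linarith) _))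
  nlinarith [hE0 t ht]

theorem fast_component_dissipation {a b K U ω γ s τ : ℝ} (ha : a < 0) (hs0 : 0 ≤ s) (hs1 : s ≤ 1)
    (hγ : |γ| ≤ K) (hτ0 : 0 < τ) (hτ : 4 * |b / a| / |a| ≤ τ) :
    2 * a * ω ^ 2 + 2 * a * γ * ω + 2 * b * U * ω * s + 2 * (b / a / τ) * ω ^ 2 ≤
      (-(|a| / 2)) * ω ^ 2 + 2 * b ^ 2 / |a| * U ^ 2 + 2 * |a| * K ^ 2 := by
  have hapos : 0 < |a| := abs_pos.2 ha.ne
  have ha' : a = -|a| := by rw [abs_of_neg ha]; ring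
  have e2 : 2 * (b / a / τ) * ω ^ 2 ≤ |a| / 2 * ω ^ 2 := by
    refine mul_le_mul_of_nonneg_right ?_ (sq_nonneg _)
    have : b / a / τ ≤ |a| / 4 := by
      rw [div_le_iff₀ hτ0]
      rw [div_le_iff₀ hapos] at hτ
      linarith [le_abs_self (b / a)]
    linarith
  generalize b / a / τ = q at *
  generalize |a| = α at *
  subst ha'
  have e3 : 2 * b * U * ω * s ≤ α / 2 * ω ^ 2 + 2 * b ^ 2 / α * U ^ 2 := by
    have h5 : 0 ≤ (α * (ω * s) - 2 * b * U) ^ 2 / (2 * α) := by positivity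
    have h6 : (α * (ω * s) - 2 * b * U) ^ 2 / (2 * α) = α / 2 * (ω ^ 2 * s ^ 2)
        - 2 * b * U * ω * s + 2 * b ^ 2 / α * U ^ 2 := by
      field_simp
      ring
    have h7 : ω ^ 2 * s ^ 2 ≤ ω ^ 2 * 1 :=
      mul_le_mul_of_nonneg_left (pow_le_one₀ hs0 hs1) (sq_nonneg _)
    have h8 := mul_le_mul_of_nonneg_left h7 (half_pos hapos).le
    linarith
  have e4 : -2 * α * γ * ω ≤ α / 2 * ω ^ 2 + 2 * α * K ^ 2 := by
    have h8 : γ ^ 2 ≤ K ^ 2 := sq_le_sq' (abs_le.1 hγ).1 (abs_le.1 hγ).2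
    have h9 : 0 ≤ α / 2 * (ω + 2 * γ) ^ 2 := by positivity
    have h10 := mul_le_mul_of_nonneg_left h8 hapos.le
    linarith
  linarith

/-- The Lyapunov estimate for the slow component `U` of the coupled system. -/
theorem slow_component_bounded {U w β : ℝ → ℝ} {a b K T : ℝ} (ha : a < 0) (hab : a + b ≤ 0)
    (hT : 0 ≤ T)
    (hU : ∀ t ≥ T, HasDerivAt U (-(1 + b / a) * U t / (1 + t) - b / a ^ 2 * w t / (1 + t) ^ 2) t)
    (hw : ∀ t ≥ T, HasDerivAt w (a * w t + a * β t + b * U t + b / a * w t / (1 + t)) t)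
    (hβ : ∀ t ≥ T, |β t| ≤ K * (1 + t) ^ (3 / 4 : ℝ)) :
    ∃ C, ∃ T' ≥ T, ∀ t ≥ T', |U t| ≤ C := by
  obtain ⟨T', hTT', hT'⟩ : ∃ T' ≥ T, 4 * |b / a| / |a| ≤ 1 + T' :=
    ⟨max T (4 * |b / a| / |a|), le_max_left _ _, by linarith [le_max_right T (4 * |b / a| / |a|)]⟩
  have ha' : |a| = -a := abs_of_neg ha
  have hapos : 0 < |a| := abs_pos.2 ha.ne
  set k : ℝ := 2 * (b / a ^ 2) ^ 2 / |a| with hk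
  have hk0 : 0 ≤ k := by positivity
  have hka : k * |a| = 2 * (b / a ^ 2) ^ 2 := by rw [hk]; field_simp
  have hγ : 0 ≤ 1 + b / a := by
    have : 1 + b / a = (a + b) / a := by rw [add_div, div_self ha.ne]
    rw [this]
    exact div_nonneg_of_nonpos hab ha.le
  set φ : ℝ → ℝ := fun t => (1 + t) ^ (-(5 / 4) : ℝ) with hφ
  set s : ℝ → ℝ := fun t => (1 + t) ^ (-(3 / 4) : ℝ) with hs
  have hsφ : ∀ t ≥ T', φ t * s t = 1 / (1 + t) ^ 2 := by
    intro t ht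
    have : 0 < 1 + t := by linarith
    simp only [hφ, hs]
    rw [← rpow_add this, one_div, ← rpow_natCast, ← rpow_neg this.le]
    norm_num
  have hsφ2 : ∀ t ≥ T', φ t * s t ^ 2 = (1 + t) ^ (-(11 / 4) : ℝ) := by
    intro t ht
    have : 0 < 1 + t := by linarith
    simp only [hφ, hs]
    rw [← rpow_natCast, ← rpow_mul this.le, ← rpow_add this]
    norm_num
  set U' : ℝ → ℝ := fun t => -(1 + b / a) * U t / (1 + t) - b / a ^ 2 * w t / (1 + t) ^ 2 with hU'
  set w' : ℝ → ℝ := fun t => a * w t + a * β t + b * U t + b / a * w t / (1 + t) with hw'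
  have hE : ∀ t ≥ T', HasDerivAt (fun t => U t ^ 2 + k * ((1 + t) ^ (-(11 / 4) : ℝ) * w t ^ 2))
      (2 * U t * U' t + k * (-(11 / 4) * (1 + t) ^ (-(15 / 4) : ℝ) * w t ^ 2 +
        (1 + t) ^ (-(11 / 4) : ℝ) * (2 * w t * w' t))) t := by
    intro t ht
    have h0 : HasDerivAt (fun t : ℝ => 1 + t) 1 t := (hasDerivAt_id t).const_add 1
    have h1 := h0.rpow_const (p := (-(11 / 4) : ℝ)) (Or.inl (by linarith))
    have h2 := (hU t (hTT'.trans ht)).pow 2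
    have h3 := (hw t (hTT'.trans ht)).pow 2
    refine (h2.add ((h1.mul h3).const_mul k)).congr_deriv ?_
    rw [show (-(11 / 4) - 1 : ℝ) = -(15 / 4) by norm_num]
    simp only [hU', hw']
    push_cast
    simp
  have key : ∃ D, ∀ t ≥ T', U t ^ 2 + k * ((1 + t) ^ (-(11 / 4) : ℝ) * w t ^ 2) ≤ D := by
    refine bounded_of_deriv_le_rpow (C := 1 + 2 * k * b ^ 2 / |a| + 2 * k * |a| * K ^ 2)
      (hT.trans hTT') hE ?_ (by positivity) (fun t ht => ?_)
    · intro t ht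
      have hτ : 1 ≤ 1 + t := by linarith
      have hτ0 : 0 < 1 + t := by linarith
      have hφ0 : 0 < φ t := rpow_pos_of_pos hτ0 _
      have hs0 : 0 < s t := rpow_pos_of_pos hτ0 _
      have hs1 : s t ≤ 1 := rpow_le_one_of_one_le_of_nonpos hτ (by norm_num)
      have hsβ : |s t * β t| ≤ K := by
        rw [abs_mul, abs_of_pos hs0]
        have h := mul_le_mul_of_nonneg_left (hβ t (hTT'.trans ht)) hs0.le
        have h2 : s t * (1 + t) ^ (3 / 4 : ℝ) = 1 := by
          simp only [hs]
          rw [← rpow_add hτ0]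
          norm_num
        calc s t * |β t| ≤ K * (s t * (1 + t) ^ (3 / 4 : ℝ)) := by linarith
          _ = K := by rw [h2, mul_one]
      set ω : ℝ := s t * w t with hω
      have hUU : 2 * U t * U' t ≤ φ t * (U t ^ 2 + (b / a ^ 2) ^ 2 * ω ^ 2) := by
        have e1 : U' t = -(1 + b / a) * U t / (1 + t) - b / a ^ 2 * (φ t * ω) := by
          have := hsφ t ht
          simp only [hU', hω]
          rw [show φ t * (s t * w t) = φ t * s t * w t by ring, this]
          ring
        have e2 : 0 ≤ (1 + b / a) * U t ^ 2 / (1 + t) := by positivity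
        have e3 : 0 ≤ φ t * (U t + b / a ^ 2 * ω) ^ 2 := by positivity
        have e5 : φ t * (U t + b / a ^ 2 * ω) ^ 2 = φ t * (U t ^ 2 + (b / a ^ 2) ^ 2 * ω ^ 2)
            + 2 * U t * (b / a ^ 2) * (φ t * ω) := by ring
        have e4 : 2 * U t * U' t = -2 * ((1 + b / a) * U t ^ 2 / (1 + t))
            - 2 * U t * (b / a ^ 2) * (φ t * ω) := by
          rw [e1]; ring
        linarith
      have hww : s t ^ 2 * (2 * w t * w' t) ≤
          (-(|a| / 2)) * ω ^ 2 + 2 * b ^ 2 / |a| * U t ^ 2 + 2 * |a| * K ^ 2 := by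
        have e1 : s t ^ 2 * (2 * w t * w' t) = 2 * a * ω ^ 2 + 2 * a * (s t * β t) * ω
            + 2 * b * U t * ω * s t + 2 * (b / a / (1 + t)) * ω ^ 2 := by
          simp only [hw', hω]; ring
        rw [e1]
        exact fast_component_dissipation ha hs0.le hs1 hsβ hτ0 (hT'.trans (by linarith))
      have h11 : (1 + t) ^ (-(11 / 4) : ℝ) * (2 * w t * w' t)
          = φ t * (s t ^ 2 * (2 * w t * w' t)) := by
        rw [← hsφ2 t ht]; ring
      have h12 : 0 ≤ (1 + t) ^ (-(15 / 4) : ℝ) * w t ^ 2 := by positivity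
      have h13 : 0 ≤ (1 + t) ^ (-(11 / 4) : ℝ) * w t ^ 2 := by positivity
      have h14 : k * (φ t * (s t ^ 2 * (2 * w t * w' t))) ≤ k * (φ t * ((-(|a| / 2)) * ω ^ 2
          + 2 * b ^ 2 / |a| * U t ^ 2 + 2 * |a| * K ^ 2)) := by gcongr
      have h15 : k * (φ t * ((-(|a| / 2)) * ω ^ 2 + 2 * b ^ 2 / |a| * U t ^ 2 + 2 * |a| * K ^ 2))
         = φ t * (-(b / a ^ 2) ^ 2 * ω ^ 2 + 2 * k * b ^ 2 / |a| * U t ^ 2 + 2 * k * |a| * K ^ 2) := by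
        have : (b / a ^ 2) ^ 2 = k * |a| / 2 := by rw [hka]; ring
        rw [this]; ring
      rw [h11]
      have h16 : 0 ≤ 2 * k * b ^ 2 / |a| := by positivity
      have h17 : 0 ≤ 2 * k * |a| * K ^ 2 := by positivity
      set A := 2 * k * b ^ 2 / |a|
      set B := 2 * k * |a| * K ^ 2
      set X := k * ((1 + t) ^ (-(11 / 4) : ℝ) * w t ^ 2)
      have hX : 0 ≤ X := by positivity
      calc 2 * U t * U' t + k * (-(11 / 4) * (1 + t) ^ (-(15 / 4) : ℝ) * w t ^ 2 +
            φ t * (s t ^ 2 * (2 * w t * w' t)))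
          ≤ φ t * (U t ^ 2 + A * U t ^ 2 + B) := by
            rw [h15] at h14
            have h18 := mul_le_mul_of_nonneg_left hww (mul_nonneg hk0 hφ0.le)
            have h19 := mul_nonneg hk0 h12
            linarith
        _ ≤ φ t * ((1 + A + B) * (U t ^ 2 + X + 1)) := by
            refine mul_le_mul_of_nonneg_left ?_ hφ0.le
            nlinarith [mul_nonneg h16 hX, mul_nonneg h17 hX, mul_nonneg h17 (sq_nonneg (U t))]
        _ = _ := by simp only [hφ]; ring
    · have : 0 ≤ (1 + t) ^ (-(11 / 4) : ℝ) := rpow_nonneg (by linarith) _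
      positivity
  obtain ⟨D, hD⟩ := key
  refine ⟨√D, T', hTT', fun t ht => abs_le_sqrt (le_trans ?_ (hD t ht))⟩
  have : 0 ≤ (1 + t) ^ (-(11 / 4) : ℝ) := rpow_nonneg (by linarith) _
  have : 0 ≤ k * ((1 + t) ^ (-(11 / 4) : ℝ) * w t ^ 2) := by positivity
  linarith

/-- The memory term perturbs the solution of the linear equation only by a bounded amount. -/
theorem memory_perturbation_bounded {x β w J p : ℝ → ℝ} {a b K L T : ℝ} (ha : a < 0)
    (hab : a + b ≤ 0) (hT : 0 ≤ T) (hx : ∀ t ≥ T, x t = w t + β t)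
    (hw : ∀ t ≥ T, HasDerivAt w (a * x t + b / (1 + t) * J t) t)
    (hJ : ∀ t ≥ T, HasDerivAt J (x t) t)
    (hp : ∀ t ≥ T, HasDerivAt p (a * (p t + β t)) t)
    (hβ : ∀ t ≥ T, |β t| ≤ K * (1 + t) ^ (3 / 4 : ℝ))
    (hy : ∀ t ≥ T, |p t + β t| ≤ L * (1 + t)) :
    ∃ C, ∃ T' ≥ T, ∀ t ≥ T', |w t - p t| ≤ C := by
  have hJw : ∀ t ≥ T, J t = (1 + t) * (J t / (1 + t) - w t / (a * (1 + t))) + w t / a := by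
    intro t ht
    have : 1 + t ≠ 0 := by linarith
    have := ha.ne
    field_simp
    ring
  obtain ⟨C, T₁, hT₁, hC⟩ := slow_component_bounded (U := fun t => J t / (1 + t) - w t / (a * (1 + t)))
    (w := w) (β := β) (K := K) ha hab hT
    (fun t ht => by
      have h1 : 1 + t ≠ 0 := by linarith
      have h2 := ha.ne
      have h0 : HasDerivAt (fun t : ℝ => 1 + t) 1 t := (hasDerivAt_id t).const_add 1
      refine (((hJ t ht).div h0 h1).sub ((hw t ht).div (h0.const_mul a)
        (mul_ne_zero h2 h1))).congr_deriv ?_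
      rw [hx t ht]
      field_simp
      ring)
    (fun t ht => by
      have h1 : 1 + t ≠ 0 := by linarith
      have h2 := ha.ne
      refine (hw t ht).congr_deriv ?_
      rw [hx t ht]
      field_simp
      ring) hβ
  have hapos : 0 < |a| := abs_pos.2 ha.ne
  obtain ⟨T', hTT', hT'⟩ : ∃ T' ≥ T₁, 2 * |b / a| / |a| ≤ 1 + T' :=
    ⟨max T₁ (2 * |b / a| / |a|), le_max_left _ _, by linarith [le_max_right T₁ (2 * |b / a| / |a|)]⟩
  obtain ⟨D, hD⟩ := bounded_of_dissipative (u := fun t => w t - p t) (T := T')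
    (u' := fun t => a * (w t - p t) + b / (1 + t) * J t) (half_pos hapos)
    (K := |b| * C + |b / a| * (L + |K|))
    (fun t ht => by
      have ht' := hT₁.trans (hTT'.trans ht)
      refine ((hw t ht').sub (hp t ht')).congr_deriv ?_
      rw [hx t ht']
      ring)
    (fun t ht => by
      have ht' := hT₁.trans (hTT'.trans ht)
      have hτ : 0 < 1 + t := by linarith
      have hU := hC t (hTT'.trans ht)
      set U := J t / (1 + t) - w t / (a * (1 + t)) with hUdef
      set z := w t - p t with hz
      have hpb : |p t / (1 + t)| ≤ L + |K| := by
        rw [abs_div, abs_of_pos hτ, div_le_iff₀ hτ]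
        have h1 : |p t| ≤ |p t + β t| + |β t| := by
          simpa using abs_sub (p t + β t) (β t)
        have h2 : (1 + t) ^ (3 / 4 : ℝ) ≤ 1 + t := by
          conv_rhs => rw [← rpow_one (1 + t)]
          exact rpow_le_rpow_of_exponent_le (by linarith) (by norm_num)
        have h3 : K * (1 + t) ^ (3 / 4 : ℝ) ≤ |K| * (1 + t) :=
          mul_le_mul (le_abs_self K) h2 (by positivity) (abs_nonneg K)
        linarith [hβ t ht', hy t ht']
      have hJz : b / (1 + t) * J t = b * U + b / a / (1 + t) * z + b / a * (p t / (1 + t)) := by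
        have := ha.ne
        rw [hJw t ht', ← hUdef, hz]
        field_simp
        ring
      have e1 : b / a / (1 + t) ≤ |a| / 2 := by
        rw [div_le_iff₀ hapos] at hT'
        rw [div_le_iff₀ hτ]
        nlinarith [le_abs_self (b / a), mul_le_mul_of_nonneg_left ht hapos.le]
      have e2 : z * (b * U) ≤ |z| * (|b| * C) := by
        calc z * (b * U) ≤ |z * (b * U)| := le_abs_self _
          _ = |z| * (|b| * |U|) := by rw [abs_mul, abs_mul]
          _ ≤ _ := by gcongr
      have e3 : z * (b / a * (p t / (1 + t))) ≤ |z| * (|b / a| * (L + |K|)) := by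
        calc z * (b / a * (p t / (1 + t))) ≤ |z * (b / a * (p t / (1 + t)))| := le_abs_self _
          _ = |z| * (|b / a| * |p t / (1 + t)|) := by rw [abs_mul, abs_mul]
          _ ≤ _ := by gcongr
      have e4 : a = -|a| := by rw [abs_of_neg ha]; ring
      have e5 : b / a / (1 + t) * z ^ 2 ≤ |a| / 2 * z ^ 2 :=
        mul_le_mul_of_nonneg_right e1 (sq_nonneg z)
      have e6 : a * z ^ 2 = -|a| * z ^ 2 := by rw [← e4]
      simp only [hJz]
      nlinarith)
  exact ⟨D, T', hT₁.trans hTT', hD⟩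

/-- Over one time step, the linear equation driven by `β` is well approximated by its exact
homogeneous flow plus the increment of `β`. -/
theorem linear_flow_step {β p : ℝ → ℝ} {a h s η : ℝ} (ha : a < 0)
    (hp : ∀ t, HasDerivAt p (a * (p t + β t)) t)
    (hη : ∀ t ∈ Icc s (s + h), |β t - β s| ≤ η) {t : ℝ} (ht : t ∈ Icc s (s + h)) :
    |p t + β t - (exp (a * (t - s)) * (p s + β s) + (β t - β s))| ≤ |a| * h * η := by
  have hderiv : ∀ r, HasDerivAt (fun r => exp (a * (t - r)) * (p r + β s))
      (exp (a * (t - r)) * (a * (β r - β s))) r := by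
    intro r
    have h0 : HasDerivAt (fun r : ℝ => a * (t - r)) (a * -1) r :=
      ((hasDerivAt_id r).const_sub t).const_mul a
    refine (h0.exp.mul ((hp r).add_const (β s))).congr_deriv ?_
    ring
  have hη0 : 0 ≤ η := (abs_nonneg _).trans (hη t ht)
  have hmv := Convex.norm_image_sub_le_of_norm_hasDerivWithin_le (C := |a| * η)
    (f := fun r => exp (a * (t - r)) * (p r + β s)) (s := Icc s t) (x := s) (y := t)
    (fun r _ => (hderiv r).hasDerivWithinAt)
    (fun r hr => by
      rw [norm_mul, norm_mul, norm_eq_abs, norm_eq_abs, norm_eq_abs, abs_of_pos (exp_pos _)]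
      have h1 : exp (a * (t - r)) ≤ 1 := exp_le_one_iff.2 (by nlinarith [hr.2])
      have h2 := hη r ⟨hr.1, hr.2.trans ht.2⟩
      calc _ ≤ 1 * (|a| * η) := by gcongr
        _ = _ := one_mul _)
    (convex_Icc s t) (left_mem_Icc.2 ht.1) (right_mem_Icc.2 ht.1)
  simp only [sub_self, mul_zero, exp_zero, one_mul, norm_eq_abs] at hmv
  rw [abs_of_nonneg (sub_nonneg.2 ht.1)] at hmv
  calc _ = |p t + β s - exp (a * (t - s)) * (p s + β s)| := by congr 1; ring
    _ ≤ |a| * η * (t - s) := hmv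
    _ ≤ |a| * η * h := by gcongr; linarith [ht.2]
    _ = _ := by ring

theorem half_le_one_sub_exp_neg {u : ℝ} (h0 : 0 ≤ u) (h1 : u ≤ 1) : u / 2 ≤ 1 - exp (-u) := by
  have h2 : exp (-u) * (1 + u) ≤ 1 := by
    calc exp (-u) * (1 + u) ≤ exp (-u) * exp u := by
          gcongr; linarith [add_one_le_exp u]
      _ = 1 := by rw [← exp_add]; simp
  nlinarith [exp_pos (-u)]

/-- The solution of the linear equation stays close to its autoregressive discretisation. -/
theorem discretisation_error {β p : ℝ → ℝ} {a h : ℝ} (ha : a < 0) (h0 : 0 < h) (hah : |a| * h ≤ 1)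
    (hp : ∀ t, HasDerivAt p (a * (p t + β t)) t) {v : ℕ → ℝ}
    (hv : ∀ k : ℕ, v (k + 1) = exp (a * h) * v k + (β ((k + 1 : ℕ) * h) - β (k * h)))
    {ε : ℕ → ℝ} (hmono : Monotone ε) {N : ℕ}
    (hε : ∀ k ≥ N, ∀ t ∈ Icc ((k : ℝ) * h) (k * h + h), |β t - β (k * h)| ≤ ε k) :
    ∃ C, (∀ k ≥ N, |p (k * h) + β (k * h) - v k| ≤ C + 2 * ε k) ∧
      ∀ k ≥ N, ∀ t ∈ Icc ((k : ℝ) * h) (k * h + h), |p t + β t| ≤ |v k| + C + 4 * ε k := by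
  have hε0 : ∀ k ≥ N, 0 ≤ ε k := fun k hk =>
    (abs_nonneg _).trans (hε k hk _ (left_mem_Icc.2 (by linarith)))
  have hq : exp (a * h) = exp (-(|a| * h)) := by rw [abs_of_neg ha]; ring_nf
  have hq1 : exp (a * h) ≤ 1 := exp_le_one_iff.2 (mul_nonpos_of_nonpos_of_nonneg ha.le h0.le)
  have hq2 : |a| * h / 2 ≤ 1 - exp (a * h) := by
    rw [hq]
    exact half_le_one_sub_exp_neg (by positivity) hah
  have key : ∀ k ≥ N, |p (k * h) + β (k * h) - v k| ≤
      |p (N * h) + β (N * h) - v N| + 2 * ε k := by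
    intro k hk
    induction k, hk using Nat.le_induction with
    | base => linarith [hε0 N le_rfl]
    | succ k hk ih =>
      have hstep := linear_flow_step ha hp (hε k hk) (right_mem_Icc.2 (by linarith))
      have e : (k : ℝ) * h + h = (k + 1 : ℕ) * h := by push_cast; ring
      have e' : (k : ℝ) * h + h - k * h = h := by ring
      rw [e', e] at hstep
      set D := |p (N * h) + β (N * h) - v N|
      have hD : 0 ≤ D := abs_nonneg _
      have h1 : p ((k + 1 : ℕ) * h) + β ((k + 1 : ℕ) * h) - v (k + 1) =
          (p ((k + 1 : ℕ) * h) + β ((k + 1 : ℕ) * h) - (exp (a * h) * (p (k * h) + β (k * h))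
            + (β ((k + 1 : ℕ) * h) - β (k * h)))) + exp (a * h) * (p (k * h) + β (k * h) - v k) := by
        rw [hv]; ring
      rw [h1]
      refine (abs_add_le _ _).trans ?_
      rw [abs_mul, abs_of_pos (exp_pos _)]
      have h2 := mul_le_mul_of_nonneg_left ih (exp_pos (a * h)).le
      have h3 : ε k ≤ ε (k + 1) := hmono (Nat.le_succ k)
      have h4 := mul_le_mul_of_nonneg_right hq2 (hε0 k hk)
      have h5 := mul_le_mul_of_nonneg_right hq1 hD
      linarith
  refine ⟨|p (N * h) + β (N * h) - v N|, key, fun k hk t ht => ?_⟩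
  have hstep := linear_flow_step ha hp (hε k hk) ht
  have h1 := key k hk
  have h2 := hε k hk t ht
  have h3 : |a| * h * ε k ≤ ε k := mul_le_of_le_one_left (hε0 k hk) hah
  have h4 : exp (a * (t - k * h)) ≤ 1 :=
    exp_le_one_iff.2 (mul_nonpos_of_nonpos_of_nonneg ha.le (by linarith [ht.1]))
  have h5 : |exp (a * (t - k * h)) * (p (k * h) + β (k * h))| ≤ |p (k * h) + β (k * h)| := by
    rw [abs_mul, abs_of_pos (exp_pos _)]
    exact mul_le_of_le_one_left (abs_nonneg _) h4
  rw [abs_le] at *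
  have h6 := abs_le.1 (le_refl |v k|)
  have h7 : |p (k * h) + β (k * h)| ≤ |v k| + |p (k * h) + β (k * h) - v k| := by
    have := abs_add_le (v k) (p (k * h) + β (k * h) - v k)
    simpa using this
  have h8 := key k hk
  constructor <;> linarith [hstep.1, hstep.2, h2.1, h2.2, h5.1, h5.2]

/-- The normalisation `√(2 log t)`. -/
def logScale (t : ℝ) : ℝ := √(2 * log t)

theorem logScale_nonneg (t : ℝ) : 0 ≤ logScale t := sqrt_nonneg _

theorem logScale_sq {t : ℝ} (ht : 1 ≤ t) : logScale t ^ 2 = 2 * log t :=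
  sq_sqrt (mul_nonneg two_pos.le (log_nonneg ht))

theorem logScale_le_logScale {s t : ℝ} (hs : 0 < s) (hst : s ≤ t) : logScale s ≤ logScale t :=
  sqrt_le_sqrt (by gcongr)

theorem monotone_logScale_natCast : Monotone fun k : ℕ => logScale k := by
  intro i j hij
  rcases Nat.eq_zero_or_pos i with rfl | hi
  · simp [logScale]
  · exact logScale_le_logScale (by exact_mod_cast hi) (by exact_mod_cast hij)

theorem tendsto_logScale : Tendsto logScale atTop atTop :=
  tendsto_sqrt_atTop.comp (tendsto_log_atTop.const_mul_atTop two_pos)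

theorem logScale_mul_le {c t : ℝ} (hc : 0 < c) (ht : 1 ≤ t) :
    logScale (c * t) ≤ logScale t + √(2 * |log c|) := by
  have ht0 : 0 < t := by linarith
  have h1 := log_nonneg ht
  refine (sqrt_le_left (by positivity [logScale_nonneg t])).2 ?_
  rw [log_mul hc.ne' ht0.ne', add_sq, logScale_sq ht, sq_sqrt (by positivity)]
  have := mul_nonneg (logScale_nonneg t) (sqrt_nonneg (2 * |log c|))
  nlinarith [le_abs_self (log c)]

theorem eventually_const_le_mul_logScale (C : ℝ) {δ : ℝ} (hδ : 0 < δ) :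
    ∀ᶠ t in atTop, C ≤ δ * logScale t :=
  (tendsto_logScale.const_mul_atTop hδ).eventually_ge_atTop C

theorem logScale_natCast_le {k : ℕ} : logScale k ≤ 2 * (k : ℝ) ^ (1 / 4 : ℝ) := by
  refine (sqrt_le_left (by positivity)).2 ?_
  have h := log_le_rpow_div (x := (k : ℝ)) (by positivity) (ε := 1 / 2) (by norm_num)
  rw [mul_pow, ← rpow_natCast ((k : ℝ) ^ (1 / 4 : ℝ)), ← rpow_mul (by positivity)]
  norm_num at h ⊢
  linarith

theorem natFloor_div_spec {h t : ℝ} (h0 : 0 < h) (ht : 0 ≤ t) :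
    t ∈ Icc ((⌊t / h⌋₊ : ℝ) * h) (⌊t / h⌋₊ * h + h) := by
  constructor
  · rw [← le_div_iff₀ h0]
    exact Nat.floor_le (by positivity)
  · have := (Nat.lt_floor_add_one (t / h)).le
    rw [div_le_iff₀ h0] at this
    linarith

theorem tendsto_natFloor_div {h : ℝ} (h0 : 0 < h) :
    Tendsto (fun t : ℝ => ⌊t / h⌋₊) atTop atTop :=
  tendsto_nat_floor_atTop.comp (tendsto_id.atTop_div_const h0)

theorem growth_of_grid_growth {β : ℝ → ℝ} {h η A : ℝ} (h0 : 0 < h) (hη : 0 ≤ η) (hA : 0 ≤ A)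
    (hosc : ∀ᶠ k : ℕ in atTop, ∀ t ∈ Icc ((k : ℝ) * h) (k * h + h),
      |β t - β (k * h)| ≤ η * logScale k)
    (hgrow : ∀ᶠ k : ℕ in atTop, |β (k * h)| ≤ A * (√k * logScale k)) :
    ∃ K, ∀ᶠ t in atTop, |β t| ≤ K * (1 + t) ^ (3 / 4 : ℝ) := by
  refine ⟨2 * (A + η) * (h⁻¹) ^ (3 / 4 : ℝ), ?_⟩
  filter_upwards [(tendsto_natFloor_div h0).eventually hosc,
    (tendsto_natFloor_div h0).eventually hgrow,
    (tendsto_natFloor_div h0).eventually_ge_atTop 1, eventually_ge_atTop 0] with t h1 h2 h3 ht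
  have hspec := natFloor_div_spec h0 ht
  have h4 := h1 t hspec
  set k := ⌊t / h⌋₊
  have hk1 : (1 : ℝ) ≤ k := by exact_mod_cast h3
  have hk0 : (0 : ℝ) < k := by linarith
  have hkt : (k : ℝ) ≤ h⁻¹ * (1 + t) := by
    rw [inv_mul_eq_div, le_div_iff₀ h0]
    linarith [hspec.1]
  have hsq : √(k : ℝ) * (k : ℝ) ^ (1 / 4 : ℝ) = (k : ℝ) ^ (3 / 4 : ℝ) := by
    rw [sqrt_eq_rpow, ← rpow_add hk0]
    norm_num
  have hq : (k : ℝ) ^ (1 / 4 : ℝ) ≤ (k : ℝ) ^ (3 / 4 : ℝ) :=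
    rpow_le_rpow_of_exponent_le hk1 (by norm_num)
  have hl := logScale_natCast_le (k := k)
  have h5 : |β t| ≤ |β t - β (k * h)| + |β (k * h)| := by
    simpa using abs_add_le (β t - β (k * h)) (β (k * h))
  have h6 : √(k : ℝ) * logScale k ≤ 2 * (k : ℝ) ^ (3 / 4 : ℝ) := by
    rw [← hsq]
    nlinarith [mul_le_mul_of_nonneg_left hl (sqrt_nonneg (k : ℝ))]
  calc |β t| ≤ η * logScale k + A * (√k * logScale k) := by linarith
    _ ≤ η * (2 * (k : ℝ) ^ (3 / 4 : ℝ)) + A * (2 * (k : ℝ) ^ (3 / 4 : ℝ)) := by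
        gcongr
        linarith
    _ = 2 * (A + η) * (k : ℝ) ^ (3 / 4 : ℝ) := by ring
    _ ≤ 2 * (A + η) * (h⁻¹ * (1 + t)) ^ (3 / 4 : ℝ) := by gcongr
    _ = _ := by rw [mul_rpow (by positivity) (by linarith)]; ring

/-- Pathwise transfer of the almost sure behaviour of the discretised noise to the solution. -/
theorem path_bounds {x β w J p : ℝ → ℝ} {a b h η A r e δ : ℝ} {v : ℕ → ℝ} {m : ℕ} (ha : a < 0)
    (hab : a + b ≤ 0) (h0 : 0 < h) (hah : |a| * h ≤ 1) (hη : 0 ≤ η) (hA : 0 ≤ A) (hr : 0 ≤ r)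
    (hδ : 0 < δ) (hm : 0 < m) (hc : 0 ≤ e - exp (a * h) ^ m * r - 2 * η)
    (hx : ∀ t > 0, x t = w t + β t)
    (hw : ∀ t > 0, HasDerivAt w (a * x t + b / (1 + t) * J t) t)
    (hJ : ∀ t > 0, HasDerivAt J (x t) t)
    (hp : ∀ t, HasDerivAt p (a * (p t + β t)) t)
    (hv : ∀ k : ℕ, v (k + 1) = exp (a * h) * v k + (β ((k + 1 : ℕ) * h) - β (k * h)))
    (hosc : ∀ᶠ k : ℕ in atTop, ∀ t ∈ Icc ((k : ℝ) * h) (k * h + h),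
      |β t - β (k * h)| ≤ η * logScale k)
    (hgrow : ∀ᶠ k : ℕ in atTop, |β (k * h)| ≤ A * (√k * logScale k))
    (hupper : ∀ᶠ k : ℕ in atTop, |v k| ≤ r * logScale k)
    (hlower : ∃ᶠ i : ℕ in atTop,
      e * logScale i ≤ v ((i + 1) * m) - exp (a * h) ^ m * v (i * m)) :
    (∀ᶠ t in atTop, |x t| ≤ (r + 4 * η + δ) * logScale t) ∧
      ∃ᶠ t in atTop, (e - exp (a * h) ^ m * r - 2 * η - δ) * logScale t ≤ x t := by
  obtain ⟨N, hN⟩ := eventually_atTop.1 hosc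
  obtain ⟨C, hC1, hC2⟩ := discretisation_error ha h0 hah hp hv
    (monotone_logScale_natCast.const_mul hη) hN
  have hyup : ∀ δ > 0, ∀ᶠ t in atTop, |p t + β t| ≤ (r + 4 * η + δ) * logScale t := by
    intro δ hδ
    filter_upwards [(tendsto_natFloor_div h0).eventually hupper,
      (tendsto_natFloor_div h0).eventually_ge_atTop N,
      (tendsto_natFloor_div h0).eventually_ge_atTop 1, eventually_ge_atTop 1,
      eventually_const_le_mul_logScale (C + (r + 4 * η) * √(2 * |log h⁻¹|)) hδ]
      with t h1 h2 h3 ht h4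
    have hspec := natFloor_div_spec h0 (zero_le_one.trans ht)
    have h5 := hC2 _ h2 t hspec
    set k := ⌊t / h⌋₊
    have h6 : logScale k ≤ logScale t + √(2 * |log h⁻¹|) := by
      refine (logScale_le_logScale (by exact_mod_cast h3) ?_).trans
        (logScale_mul_le (inv_pos.2 h0) ht)
      rw [inv_mul_eq_div, le_div_iff₀ h0]
      exact hspec.1
    have h7 := mul_le_mul_of_nonneg_left h6 (show 0 ≤ r + 4 * η by positivity)
    linarith
  obtain ⟨K, hK⟩ := growth_of_grid_growth h0 hη hA hosc hgrow
  have hylin : ∀ᶠ t in atTop, |p t + β t| ≤ (2 * (r + 4 * η + 1)) * (1 + t) := by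
    filter_upwards [hyup 1 one_pos, eventually_ge_atTop 1] with t h1 ht
    refine h1.trans ?_
    have h2 : logScale t ≤ 2 * (1 + t) := by
      refine (sqrt_le_left (by linarith)).2 ?_
      nlinarith [log_le_sub_one_of_pos (show 0 < t by linarith)]
    calc _ ≤ (r + 4 * η + 1) * (2 * (1 + t)) := by gcongr
      _ = _ := by ring
  obtain ⟨T, hT⟩ := eventually_atTop.1 (hK.and (hylin.and (eventually_gt_atTop 0)))
  have hT0 : 0 < T := (hT T le_rfl).2.2
  obtain ⟨D, T', hT', hD⟩ := memory_perturbation_bounded (x := x) (p := p) ha hab hT0.le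
    (fun t ht => hx t (hT0.trans_le ht)) (fun t ht => hw t (hT0.trans_le ht))
    (fun t ht => hJ t (hT0.trans_le ht)) (fun t _ => hp t)
    (fun t ht => (hT t ht).1) (fun t ht => (hT t ht).2.1)
  have hxy : ∀ t ≥ T', |x t - (p t + β t)| ≤ D := by
    intro t ht
    rw [hx t (hT0.trans_le (hT'.trans ht)), add_sub_add_right_eq_sub]
    exact hD t ht
  constructor
  · filter_upwards [hyup (δ / 2) (half_pos hδ), eventually_ge_atTop T',
      eventually_const_le_mul_logScale D (half_pos hδ)] with t h1 h2 h3
    have h4 := hxy t h2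
    have h5 : |x t| ≤ |x t - (p t + β t)| + |p t + β t| := by
      simpa using abs_add_le (x t - (p t + β t)) (p t + β t)
    linarith
  · have hmh : (0 : ℝ) < m * h := mul_pos (by exact_mod_cast hm) h0
    have htend : Tendsto (fun i : ℕ => ((i : ℝ) + 1) * (m * h)) atTop atTop :=
      (tendsto_atTop_add_const_right _ _ tendsto_natCast_atTop_atTop).atTop_mul_const hmh
    have htend' : Tendsto (fun i : ℕ => i * m) atTop atTop :=
      tendsto_id.atTop_mul_const' hm
    set q := exp (a * h) ^ m with hq
    have hq0 : 0 ≤ q := by positivity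
    refine htend.frequently ?_
    refine (hlower.and_eventually ((htend'.eventually hupper).and
      ((htend'.eventually_ge_atTop N).and ((htend.eventually_ge_atTop T').and
      ((eventually_ge_atTop 1).and (htend.eventually
        (eventually_const_le_mul_logScale (C + D + (q * r) * √(2 * |log m|)
          + 2 * η * √(2 * |log (2 * m)|)
          + (e - q * r - 2 * η) * √(2 * |log (2 * (m * h))|)) hδ))))))).mono ?_
    rintro i ⟨hlow, hup, hiN, hiT, hi1, hconst⟩
    have hi1' : (1 : ℝ) ≤ i := by exact_mod_cast hi1
    have hm0 : (0 : ℝ) < m := by exact_mod_cast hm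
    set t := ((i : ℝ) + 1) * (m * h) with ht
    have hscale : ∀ c > (0 : ℝ), logScale ((i + 1) * c) ≤ logScale i + √(2 * |log (2 * c)|) := by
      intro c hc0
      refine (logScale_le_logScale (by positivity) ?_).trans
        (logScale_mul_le (by positivity) hi1')
      nlinarith
    have h1 : logScale ((i * m : ℕ) : ℝ) ≤ logScale i + √(2 * |log m|) := by
      rw [Nat.cast_mul, mul_comm]
      exact logScale_mul_le hm0 hi1'
    have h2 : logScale (((i + 1) * m : ℕ) : ℝ) ≤ logScale i + √(2 * |log (2 * m)|) := by
      push_cast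
      exact hscale m hm0
    have h3 := hscale _ hmh
    rw [← ht] at h3
    have h4 := hC1 ((i + 1) * m) (hiN.trans (Nat.mul_le_mul_right m i.le_succ))
    rw [show (((i + 1) * m : ℕ) : ℝ) * h = t by push_cast; ring] at h4
    have h5 := (abs_le.1 (hxy t hiT)).1
    have h6 := (abs_le.1 hup).1
    have h7 := (abs_le.1 h4).1
    have h8 := mul_le_mul_of_nonneg_left h1 (mul_nonneg hq0 hr)
    have h9 := mul_le_mul_of_nonneg_left h2 (mul_nonneg two_pos.le hη)
    have h10 := mul_le_mul_of_nonneg_left h3 hc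
    have h11 := mul_le_mul_of_nonneg_left h6 hq0
    linarith

theorem ae_eventually_notMem_of_summable {Ω : Type*} {mΩ : MeasurableSpace Ω} {P : Measure Ω}
    [IsProbabilityMeasure P] {s : ℕ → Set Ω} {f : ℕ → ℝ} (hf : Summable f)
    (hs : ∀ᶠ k in atTop, P (s k) ≤ ENNReal.ofReal (f k)) :
    ∀ᵐ ω ∂P, ∀ᶠ k in atTop, ω ∉ s k := by
  obtain ⟨N, hN⟩ := eventually_atTop.1 hs
  have h1 : ∑' k, P (s (k + N)) ≠ ⊤ := by
    refine ne_top_of_le_ne_top (((summable_nat_add_iff N).2 hf).tsum_ofReal_ne_top)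
      (ENNReal.tsum_le_tsum fun k => hN _ (Nat.le_add_left _ _))
  filter_upwards [ae_eventually_notMem h1] with ω hω
  rw [← map_add_atTop_eq_nat N]
  exact eventually_map.2 hω

theorem measure_abs_ge_le_of_gaussianReal {Ω : Type*} {mΩ : MeasurableSpace Ω} {P : Measure Ω}
    [IsProbabilityMeasure P] {G : Ω → ℝ} {v w : NNReal} (hG : AEMeasurable G P)
    (hGv : P.map G = gaussianReal 0 v) (hvw : v ≤ w) {x : ℝ} (hx : 0 ≤ x) :
    P {ω | x ≤ |G ω|} ≤ ENNReal.ofReal (2 * exp (-x ^ 2 / (2 * w))) := by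
  have hsub : HasSubgaussianMGF G w P := by
    constructor
    · intro t
      have := integrable_exp_mul_gaussianReal (μ := 0) (v := v) t
      rw [← hGv] at this
      exact this.comp_aemeasurable hG
    · intro t
      rw [mgf_gaussianReal hGv, zero_mul, zero_add]
      gcongr
  have h1 := hsub.measure_ge_le hx
  have h2 := hsub.neg.measure_ge_le hx
  have h3 : {ω | x ≤ |G ω|} ⊆ {ω | x ≤ G ω} ∪ {ω | x ≤ (-G) ω} := fun ω hω => by
    simpa [le_abs] using hω
  rw [← ENNReal.ofReal_toReal (measure_ne_top P _)]
  refine ENNReal.ofReal_le_ofReal ?_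
  calc P.real {ω | x ≤ |G ω|} ≤ P.real ({ω | x ≤ G ω} ∪ {ω | x ≤ (-G) ω}) :=
        measureReal_mono h3
    _ ≤ P.real {ω | x ≤ G ω} + P.real {ω | x ≤ (-G) ω} := measureReal_union_le _ _
    _ ≤ _ := by linarith

/-- A Gaussian tail bound at the scale `logScale k`, expressed as a power of `k`. -/
theorem measure_logScale_le_abs_le {Ω : Type*} {mΩ : MeasurableSpace Ω} {P : Measure Ω}
    [IsProbabilityMeasure P] {G : Ω → ℝ} {v w : NNReal} (hG : AEMeasurable G P)
    (hGv : P.map G = gaussianReal 0 v) (hvw : v ≤ w) (hw : w ≠ 0) {c γ : ℝ} (hc : 0 ≤ c)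
    (hγ : γ * w ≤ c ^ 2) {k : ℕ} (hk : 1 ≤ k) :
    P {ω | c * logScale k ≤ |G ω|} ≤ ENNReal.ofReal (2 * (k : ℝ) ^ (-γ)) := by
  refine (measure_abs_ge_le_of_gaussianReal hG hGv hvw
    (mul_nonneg hc (logScale_nonneg _))).trans (ENNReal.ofReal_le_ofReal ?_)
  have hk' : (1 : ℝ) ≤ k := by exact_mod_cast hk
  have hw0 : (0 : ℝ) < w := by positivity
  rw [rpow_def_of_pos (by linarith), mul_pow, logScale_sq hk']
  gcongr
  rw [div_le_iff₀ (by positivity)]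
  nlinarith [mul_le_mul_of_nonneg_right hγ (log_nonneg hk')]

theorem le_gaussianReal_Ici {v : NNReal} (hv : v ≠ 0) {x : ℝ} (hx : 0 ≤ x) :
    ENNReal.ofReal ((√(2 * π * v))⁻¹ * exp (-(x + 1) ^ 2 / (2 * v))) ≤
      gaussianReal 0 v (Ici x) := by
  have h1 : gaussianReal 0 v (Icc x (x + 1)) ≤ gaussianReal 0 v (Ici x) :=
    measure_mono Icc_subset_Ici_self
  refine le_trans ?_ h1
  rw [gaussianReal_apply _ hv]
  calc _ = ∫⁻ _ in Icc x (x + 1),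
        ENNReal.ofReal ((√(2 * π * v))⁻¹ * exp (-(x + 1) ^ 2 / (2 * v))) := by simp
    _ ≤ _ := by
      refine setLIntegral_mono' measurableSet_Icc fun y hy => ?_
      rw [gaussianPDF, gaussianPDFReal]
      have : 0 ≤ y := hx.trans hy.1
      gcongr
      linarith [hy.2]

theorem le_measure_logScale_le_of_gaussianReal {Ω : Type*} {mΩ : MeasurableSpace Ω}
    {P : Measure Ω} {G : Ω → ℝ} {v : NNReal} (hG : Measurable G)
    (hGv : P.map G = gaussianReal 0 v) {s : ℝ} (hs : 0 ≤ s) (hsv : s ^ 2 < v) :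
    ∃ c > 0, ∀ᶠ i : ℕ in atTop,
      ENNReal.ofReal (c * (i : ℝ)⁻¹) ≤ P {ω | s * logScale i ≤ G ω} := by
  have hv : v ≠ 0 := by
    rintro rfl
    simp at hsv
    nlinarith [sq_nonneg s]
  have hv0 : (0 : ℝ) < v := by positivity
  refine ⟨(√(2 * π * v))⁻¹ , by positivity, ?_⟩
  have hsv' : 0 < √v - s := by
    rw [sub_pos]
    exact lt_sqrt_of_sq_lt hsv
  filter_upwards [tendsto_natCast_atTop_atTop.eventually
    (eventually_const_le_mul_logScale 1 hsv'), eventually_ge_atTop 1] with i h1 hi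
  have hi' : (1 : ℝ) ≤ i := by exact_mod_cast hi
  have h2 := le_gaussianReal_Ici hv (mul_nonneg hs (logScale_nonneg i))
  rw [← hGv, Measure.map_apply hG measurableSet_Ici] at h2
  refine le_trans (ENNReal.ofReal_le_ofReal ?_) h2
  gcongr
  have h3 : (s * logScale i + 1) ^ 2 ≤ v * (2 * log i) := by
    rw [← logScale_sq hi', ← sq_sqrt hv0.le, ← mul_pow]
    have := mul_nonneg hs (logScale_nonneg i)
    gcongr
    · linarith
  rw [← exp_log (show (0 : ℝ) < i by linarith), ← exp_neg, exp_log (by linarith)]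
  gcongr
  rw [le_div_iff₀ (by positivity)]
  linarith

theorem abs_sub_le_of_dyadic_increments {f : ℝ → ℝ} (hf : Continuous f) {s h D : ℝ} (h0 : 0 < h)
    (hinc : ∀ n j : ℕ, j < 2 ^ n →
      |f (s + (j + 1) * (h / 2 ^ n)) - f (s + j * (h / 2 ^ n))| ≤ D / 4 * (3 / 4) ^ n) {t : ℝ}
    (ht : t ∈ Icc s (s + h)) : |f t - f s| ≤ D := by
  have hD : 0 ≤ D := by
    have := (abs_nonneg _).trans (hinc 0 0 (by norm_num))
    norm_num at this
    linarith
  have hdy : ∀ n j : ℕ, j ≤ 2 ^ n → |f (s + j * (h / 2 ^ n)) - f s| ≤ D * (1 - (3 / 4) ^ (n + 1)) := by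
    intro n
    induction n with
    | zero =>
      intro j hj
      have h1 := hinc 0 0 (by norm_num)
      interval_cases j
      · norm_num
        linarith
      · norm_num at h1 ⊢
        linarith
    | succ n ih =>
      intro j hj
      have hstep : h / 2 ^ n = 2 * (h / 2 ^ (n + 1)) := by
        field_simp
        ring
      rcases Nat.even_or_odd' j with ⟨i, rfl | rfl⟩
      · have h1 := ih i (by rw [pow_succ] at hj; omega)
        rw [hstep] at h1
        push_cast
        rw [show s + 2 * (i : ℝ) * (h / 2 ^ (n + 1)) = s + i * (2 * (h / 2 ^ (n + 1))) by ring]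
        refine h1.trans (mul_le_mul_of_nonneg_left ?_ hD)
        gcongr 1 - ?_
        exact pow_le_pow_of_le_one (by norm_num) (by norm_num) (Nat.le_succ _)
      · have h1 := ih i (by rw [pow_succ] at hj; omega)
        have h2 := hinc (n + 1) (2 * i) (by omega)
        rw [hstep] at h1
        push_cast at h2 ⊢
        rw [show s + 2 * (i : ℝ) * (h / 2 ^ (n + 1)) = s + i * (2 * (h / 2 ^ (n + 1))) by ring] at h2
        have h3 := abs_sub_le (f (s + (2 * (i : ℝ) + 1) * (h / 2 ^ (n + 1))))
          (f (s + i * (2 * (h / 2 ^ (n + 1))))) (f s)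
        have h4 : (3 / 4 : ℝ) ^ (n + 1 + 1) = (3 / 4) ^ (n + 1) * (3 / 4) := pow_succ _ _
        rw [h4]
        nlinarith
  have hu0 : 0 ≤ (t - s) / h := div_nonneg (by linarith [ht.1]) h0.le
  have hu1 : (t - s) / h ≤ 1 := (div_le_one h0).2 (by linarith [ht.2])
  have htend : Tendsto (fun n : ℕ => s + ⌊(t - s) / h * (2 : ℝ) ^ n⌋₊ * (h / 2 ^ n)) atTop
      (nhds t) := by
    have h1 := ((tendsto_nat_floor_mul_div_atTop hu0).comp
      (tendsto_pow_atTop_atTop_of_one_lt (one_lt_two : (1 : ℝ) < 2))).mul_const h |>.const_add s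
    rw [div_mul_cancel₀ _ h0.ne', add_sub_cancel] at h1
    refine h1.congr fun n => ?_
    simp only [Function.comp]
    ring
  refine le_of_tendsto (((hf.tendsto t).comp htend).sub_const (f s)).abs
    (Eventually.of_forall fun n => ?_)
  refine (hdy n _ ?_).trans ?_
  · refine Nat.floor_le_of_le ?_
    push_cast
    exact mul_le_of_le_one_left (by positivity) hu1
  · have : (0 : ℝ) ≤ (3 / 4) ^ (n + 1) := by positivity
    nlinarith

section Brownian

variable {Ω : Type*} {mΩ : MeasurableSpace Ω} {P : Measure Ω} {F : MeasureTheory.Filtration ℝ mΩ}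
  {B : ℝ → Ω → ℝ}

theorem IsStdBrownian.measurable (hB : IsStdBrownian P F B) (t : ℝ) : Measurable (B t) :=
  (hB.1 t).mono (F.le t) le_rfl

variable [IsProbabilityMeasure P]

theorem IsStdBrownian.measure_oscillation_le (hB : IsStdBrownian P F B) {h η : ℝ} (h0 : 0 < h)
    (hη : 0 ≤ η) (hηh : 128 * h ≤ η ^ 2) {k : ℕ} (hk : 4 ≤ k) :
    P {ω | ∃ t ∈ Icc ((k : ℝ) * h) (k * h + h), η * logScale k < |B t ω - B (k * h) ω|} ≤
      ENNReal.ofReal (4 * (k : ℝ) ^ (-2 : ℝ)) := by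
  have hk' : (4 : ℝ) ≤ k := by exact_mod_cast hk
  set S : ℕ → ℕ → Set Ω := fun n j => {ω | η / 4 * (3 / 4) ^ n * logScale k ≤
    |B (k * h + (j + 1) * (h / 2 ^ n)) ω - B (k * h + j * (h / 2 ^ n)) ω|} with hS
  have hsub : {ω | ∃ t ∈ Icc ((k : ℝ) * h) (k * h + h), η * logScale k < |B t ω - B (k * h) ω|} ⊆
      ⋃ n, ⋃ j ∈ Finset.range (2 ^ n), S n j := by
    rintro ω ⟨t, ht, hlt⟩
    by_contra hcon
    simp only [mem_iUnion, not_exists, Finset.mem_range] at hcon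
    refine hlt.not_ge (abs_sub_le_of_dyadic_increments (hB.2.2.1 ω) h0 (fun n j hj => ?_) ht)
    have h1 := hcon n j hj
    rw [hS, mem_ofPred_eq, not_le] at h1
    linarith
  have hterm : ∀ n j, P (S n j) ≤ ENNReal.ofReal (2 * (k : ℝ) ^ (-(n + 8) : ℝ)) := by
    intro n j
    have hd : 0 < h / 2 ^ n := by positivity
    refine measure_logScale_le_abs_le
      (((hB.measurable _).sub (hB.measurable _)).aemeasurable) (hB.2.2.2.1 _ _ ?_ ?_) le_rfl
      ?_ (by positivity) ?_ (by omega)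
    · positivity
    · nlinarith
    · rw [show (k : ℝ) * h + (j + 1) * (h / 2 ^ n) - (k * h + j * (h / 2 ^ n)) = h / 2 ^ n by ring]
      exact (Real.toNNReal_pos.2 hd).ne'
    · rw [show (k : ℝ) * h + (j + 1) * (h / 2 ^ n) - (k * h + j * (h / 2 ^ n)) = h / 2 ^ n by ring,
        Real.coe_toNNReal _ hd.le]
      have hbern := one_add_mul_le_pow (show (-2 : ℝ) ≤ 1 / 8 by norm_num) n
      have h98 : ((3 / 4 : ℝ) ^ n) ^ 2 = (1 + 1 / 8) ^ n / 2 ^ n := by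
        rw [← pow_mul, mul_comm, pow_mul, ← div_pow]
        norm_num
      rw [mul_pow, h98, mul_div_assoc', mul_div_assoc']
      refine div_le_div_of_nonneg_right ?_ (by positivity)
      nlinarith [mul_le_mul_of_nonneg_left hbern (sq_nonneg η),
        mul_le_mul_of_nonneg_right hηh (show (0 : ℝ) ≤ 1 + n * (1 / 8) by positivity)]
  have hlevel : ∀ n : ℕ, P (⋃ j ∈ Finset.range (2 ^ n), S n j) ≤
      ENNReal.ofReal (2 * (k : ℝ) ^ (-2 : ℝ) * (1 / 2) ^ n) := by
    intro n
    refine (measure_biUnion_finset_le _ _).trans ((Finset.sum_le_sum fun j _ => hterm n j).trans ?_)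
    rw [Finset.sum_const, Finset.card_range, ← ENNReal.ofReal_nsmul]
    refine ENNReal.ofReal_le_ofReal ?_
    have h1 : (k : ℝ) ^ (-(n + 8) : ℝ) ≤ (k : ℝ) ^ (-2 : ℝ) * (1 / 4) ^ n := by
      calc (k : ℝ) ^ (-(n + 8) : ℝ) ≤ (k : ℝ) ^ (-2 + -n : ℝ) :=
            rpow_le_rpow_of_exponent_le (by linarith) (by linarith)
        _ = (k : ℝ) ^ (-2 : ℝ) * ((k : ℝ)⁻¹) ^ n := by
            rw [rpow_add (by linarith), rpow_neg_eq_inv_rpow _ (n : ℝ), rpow_natCast]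
        _ ≤ _ := by
            gcongr
            rw [one_div]
            gcongr
    rw [nsmul_eq_mul]
    push_cast
    calc (2 : ℝ) ^ n * (2 * (k : ℝ) ^ (-(n + 8) : ℝ))
        ≤ 2 ^ n * (2 * ((k : ℝ) ^ (-2 : ℝ) * (1 / 4) ^ n)) := by gcongr
      _ = 2 * (k : ℝ) ^ (-2 : ℝ) * (2 ^ n * (1 / 4) ^ n) := by ring
      _ = _ := by rw [← mul_pow]; norm_num
  refine (measure_mono hsub).trans ((measure_iUnion_le _).trans ?_)
  refine (ENNReal.tsum_le_tsum hlevel).trans ?_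
  rw [← ENNReal.ofReal_tsum_of_nonneg (fun n => by positivity)
    (summable_geometric_two.mul_left _), tsum_mul_left, tsum_geometric_two]
  exact ENNReal.ofReal_le_ofReal (by linarith)

theorem IsStdBrownian.ae_oscillation_le (hB : IsStdBrownian P F B) {h η : ℝ} (h0 : 0 < h)
    (hη : 0 ≤ η) (hηh : 128 * h ≤ η ^ 2) :
    ∀ᵐ ω ∂P, ∀ᶠ k : ℕ in atTop, ∀ t ∈ Icc ((k : ℝ) * h) (k * h + h),
      |B t ω - B (k * h) ω| ≤ η * logScale k := by
  have hsum : Summable fun k : ℕ => 4 * (k : ℝ) ^ (-2 : ℝ) :=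
    (Real.summable_nat_rpow.2 (by norm_num)).mul_left 4
  filter_upwards [ae_eventually_notMem_of_summable hsum (eventually_atTop.2
    ⟨4, fun k hk => hB.measure_oscillation_le h0 hη hηh hk⟩)] with ω hω
  filter_upwards [hω] with k hk t ht
  by_contra hcon
  exact hk ⟨t, ht, not_le.1 hcon⟩

theorem IsStdBrownian.ae_grid_growth (hB : IsStdBrownian P F B) {h : ℝ} (h0 : 0 < h) :
    ∀ᵐ ω ∂P, ∀ᶠ k : ℕ in atTop, |B (k * h) ω| ≤ √(2 * h) * (√k * logScale k) := by
  have hsum : Summable fun k : ℕ => 2 * (k : ℝ) ^ (-2 : ℝ) :=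
    (Real.summable_nat_rpow.2 (by norm_num)).mul_left 2
  have hmeas : ∀ k : ℕ, 1 ≤ k →
      P {ω | √(2 * h) * √k * logScale k ≤ |B (k * h) ω - B 0 ω|} ≤
        ENNReal.ofReal (2 * (k : ℝ) ^ (-2 : ℝ)) := by
    intro k hk
    have hk0 : (0 : ℝ) < k := by exact_mod_cast hk
    have hkh : 0 < (k : ℝ) * h - 0 := by rw [sub_zero]; positivity
    refine measure_logScale_le_abs_le
      (((hB.measurable _).sub (hB.measurable _)).aemeasurable)
      (hB.2.2.2.1 _ _ le_rfl (by positivity)) le_rfl (Real.toNNReal_pos.2 hkh).ne'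
      (by positivity) ?_ hk
    rw [Real.coe_toNNReal _ hkh.le, mul_pow, sq_sqrt (by positivity), sq_sqrt hk0.le]
    linarith
  filter_upwards [ae_eventually_notMem_of_summable hsum (eventually_atTop.2 ⟨1, hmeas⟩)] with ω hω
  filter_upwards [hω] with k hk
  have := (not_le.1 hk).le
  rwa [hB.2.1, sub_zero, mul_assoc] at this

end Brownian

theorem indepFun_prodMk_right {Ω α β γ : Type*} {mΩ : MeasurableSpace Ω} [MeasurableSpace α]
    [MeasurableSpace β] [MeasurableSpace γ] {P : Measure Ω} [IsProbabilityMeasure P]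
    {X : Ω → α} {Y : Ω → β} {Z : Ω → γ} (hX : Measurable X) (hY : Measurable Y)
    (hZ : Measurable Z) (hXY : IndepFun X Y P) (hXYZ : IndepFun (fun ω => (X ω, Y ω)) Z P) :
    IndepFun X (fun ω => (Y ω, Z ω)) P := by
  have := Measure.isProbabilityMeasure_map hX.aemeasurable (μ := P)
  have := Measure.isProbabilityMeasure_map hY.aemeasurable (μ := P)
  have := Measure.isProbabilityMeasure_map hZ.aemeasurable (μ := P)
  have hYZ : IndepFun Y Z P := hXYZ.comp measurable_snd measurable_id
  rw [indepFun_iff_map_prod_eq_prod_map_map hX.aemeasurable (hY.prodMk hZ).aemeasurable,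
    (indepFun_iff_map_prod_eq_prod_map_map hY.aemeasurable hZ.aemeasurable).1 hYZ]
  have h1 := (indepFun_iff_map_prod_eq_prod_map_map (hX.prodMk hY).aemeasurable
    hZ.aemeasurable).1 hXYZ
  rw [(indepFun_iff_map_prod_eq_prod_map_map hX.aemeasurable hY.aemeasurable).1 hXY] at h1
  rw [← Measure.prodAssoc_prod, ← h1, Measure.map_map MeasurableEquiv.prodAssoc.measurable
    ((hX.prodMk hY).prodMk hZ)]
  rfl

/-- The autoregressive sequence with coefficient `q` and innovations `ξ`, started from `0` at
time `k`. -/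
def autoregressive {Ω : Type*} (q : ℝ) (ξ : ℕ → Ω → ℝ) (k : ℕ) : ℕ → Ω → ℝ
  | 0 => fun _ => 0
  | j + 1 => fun ω => q * autoregressive q ξ k j ω + ξ (k + j) ω

/-- The variance after `j` steps of the autoregressive sequence whose innovations have
variance `u`. -/
def autoregressiveVar (q : ℝ) (u : NNReal) : ℕ → NNReal
  | 0 => 0
  | j + 1 => .mk (q ^ 2) (sq_nonneg q) * autoregressiveVar q u j + u

theorem coe_autoregressiveVar (q : ℝ) (u : NNReal) (j : ℕ) :
    (1 - q ^ 2) * (autoregressiveVar q u j : ℝ) = u * (1 - (q ^ 2) ^ j) := by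
  induction j with
  | zero => simp [autoregressiveVar]
  | succ j ih =>
    rw [autoregressiveVar]
    push_cast
    rw [pow_succ]
    linear_combination q ^ 2 * ih

theorem autoregressive_zero_add {Ω : Type*} (q : ℝ) (ξ : ℕ → Ω → ℝ) (k m : ℕ) (ω : Ω) :
    autoregressive q ξ 0 (k + m) ω =
      q ^ m * autoregressive q ξ 0 k ω + autoregressive q ξ k m ω := by
  induction m with
  | zero => simp [autoregressive]
  | succ m ih =>
    rw [← add_assoc]
    simp only [autoregressive, ih, zero_add]
    ring

/-- A sequence `ξ` of centred Gaussian innovations with variance `u` relative to the discrete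
filtration `G`. -/
structure IsGaussianInnovation {Ω : Type*} {mΩ : MeasurableSpace Ω} (P : Measure Ω)
    (G : MeasureTheory.Filtration ℕ mΩ) (u : NNReal) (ξ : ℕ → Ω → ℝ) : Prop where
  measurable_succ : ∀ i, Measurable[G (i + 1)] (ξ i)
  map_eq : ∀ i, P.map (ξ i) = gaussianReal 0 u
  indep : ∀ i, Indep (MeasurableSpace.comap (ξ i) Real.measurableSpace) (G i) P

namespace IsGaussianInnovation

variable {Ω : Type*} {mΩ : MeasurableSpace Ω} {P : Measure Ω}
  {G : MeasureTheory.Filtration ℕ mΩ} {u : NNReal} {ξ : ℕ → Ω → ℝ}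

theorem measurable_autoregressive (hξ : IsGaussianInnovation P G u ξ) (q : ℝ) (k j : ℕ) :
    Measurable[G (k + j)] (autoregressive q ξ k j) := by
  induction j with
  | zero => exact measurable_const
  | succ j ih =>
    exact ((ih.mono (G.mono (Nat.le_succ _)) le_rfl).const_mul q).add (hξ.measurable_succ (k + j))

theorem indepFun_of_measurable (hξ : IsGaussianInnovation P G u ξ) {i : ℕ} {β : Type*}
    [MeasurableSpace β] {f : Ω → β} (hf : Measurable[G i] f) : IndepFun f (ξ i) P :=
  (indep_of_indep_of_le_right (hξ.indep i) hf.comap_le).symm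

theorem map_autoregressive [IsProbabilityMeasure P] (hξ : IsGaussianInnovation P G u ξ)
    (q : ℝ) (k j : ℕ) :
    P.map (autoregressive q ξ k j) = gaussianReal 0 (autoregressiveVar q u j) := by
  induction j with
  | zero => simp [autoregressive, autoregressiveVar, Measure.map_const]
  | succ j ih =>
    have hm : Measurable (autoregressive q ξ k j) :=
      (hξ.measurable_autoregressive q k j).mono (G.le _) le_rfl
    have h1 : P.map (fun ω => q * autoregressive q ξ k j ω) = gaussianReal 0
        (.mk (q ^ 2) (sq_nonneg q) * autoregressiveVar q u j) := by
      have := gaussianReal_map_const_mul (μ := 0) (v := autoregressiveVar q u j) q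
      rw [← ih, Measure.map_map (by fun_prop) hm, mul_zero] at this
      exact this
    have h2 := gaussianReal_add_gaussianReal_of_indepFun
      (hξ.indepFun_of_measurable ((hξ.measurable_autoregressive q k j).const_mul q)) h1
      (hξ.map_eq (k + j))
    rw [add_zero] at h2
    exact h2

theorem indepFun_autoregressive [IsProbabilityMeasure P] (hξ : IsGaussianInnovation P G u ξ)
    (q : ℝ) (k j : ℕ) {β : Type*} [MeasurableSpace β] {f : Ω → β} (hf : Measurable[G k] f) :
    IndepFun f (autoregressive q ξ k j) P := by
  induction j with
  | zero => exact indepFun_const_right _ _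
  | succ j ih =>
    have hN := hξ.measurable_autoregressive q k j
    have hf' : Measurable[G (k + j)] f := hf.mono (G.mono (Nat.le_add_right k j)) le_rfl
    have h1 := indepFun_prodMk_right (hf.mono (G.le _) le_rfl) (hN.mono (G.le _) le_rfl)
      ((hξ.measurable_succ (k + j)).mono (G.le _) le_rfl) ih
      (hξ.indepFun_of_measurable (hf'.prodMk hN))
    exact h1.comp (ψ := fun z : ℝ × ℝ => q * z.1 + z.2) measurable_id (by fun_prop)

theorem ae_autoregressive_le [IsProbabilityMeasure P] (hξ : IsGaussianInnovation P G u ξ)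
    {q r γ : ℝ} {w : NNReal} (hw : w ≠ 0) (hvar : ∀ j, autoregressiveVar q u j ≤ w) (hr : 0 ≤ r)
    (hγ : 1 < γ) (hγr : γ * w ≤ r ^ 2) :
    ∀ᵐ ω ∂P, ∀ᶠ k : ℕ in atTop, |autoregressive q ξ 0 k ω| ≤ r * logScale k := by
  have hsum : Summable fun k : ℕ => 2 * (k : ℝ) ^ (-γ) :=
    (Real.summable_nat_rpow.2 (by linarith)).mul_left 2
  have hmeas : ∀ k : ℕ, 1 ≤ k → P {ω | r * logScale k ≤ |autoregressive q ξ 0 k ω|} ≤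
      ENNReal.ofReal (2 * (k : ℝ) ^ (-γ)) := fun k hk =>
    measure_logScale_le_abs_le
      ((hξ.measurable_autoregressive q 0 k).mono (G.le _) le_rfl).aemeasurable
      (hξ.map_autoregressive q 0 k) (hvar k) hw hr hγr hk
  filter_upwards [ae_eventually_notMem_of_summable hsum (eventually_atTop.2 ⟨1, hmeas⟩)] with ω hω
  filter_upwards [hω] with k hk
  exact (not_le.1 hk).le

theorem ae_frequently_le_autoregressive [IsProbabilityMeasure P]
    (hξ : IsGaussianInnovation P G u ξ) {q s : ℝ} {m : ℕ} (hs : 0 ≤ s)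
    (hsv : s ^ 2 < autoregressiveVar q u m) :
    ∀ᵐ ω ∂P, ∃ᶠ i : ℕ in atTop, s * logScale i ≤ autoregressive q ξ (i * m) m ω := by
  let ℋ : MeasureTheory.Filtration ℕ mΩ :=
    { seq := fun i => G (i * m)
      mono' := fun i j hij => G.mono (Nat.mul_le_mul_right m hij)
      le' := fun i => G.le _ }
  let E : ℕ → Set Ω := fun i => {ω | s * logScale i ≤ autoregressive q ξ (i * m) m ω}
  let S : ℕ → Set Ω := fun n => Nat.casesOn n ∅ E
  have hmeas : ∀ i, Measurable (autoregressive q ξ (i * m) m) := fun i =>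
    (hξ.measurable_autoregressive q _ m).mono (G.le _) le_rfl
  have hS : ∀ n, MeasurableSet[ℋ n] (S n) := by
    rintro (_ | i)
    · exact @MeasurableSet.empty _ (ℋ 0)
    · have h1 := hξ.measurable_autoregressive q (i * m) m
      rw [← Nat.succ_mul] at h1
      exact h1 measurableSet_Ici
  have hcond : ∀ k, P[(S (k + 1)).indicator (1 : Ω → ℝ) | ℋ k] =ᵐ[P] fun _ => P.real (E k) := by
    intro k
    have hind : Indep (MeasurableSpace.comap (autoregressive q ξ (k * m) m) Real.measurableSpace)
        (ℋ k) P := by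
      have h1 := @indepFun_autoregressive Ω mΩ P G u ξ _ hξ q (k * m) m Ω (ℋ k) id measurable_id
      have h2 : Indep (MeasurableSpace.comap id (ℋ k)) (MeasurableSpace.comap
        (autoregressive q ξ (k * m) m) Real.measurableSpace) P := h1
      rw [MeasurableSpace.comap_id] at h2
      exact h2.symm
    have hE : MeasurableSet[MeasurableSpace.comap (autoregressive q ξ (k * m) m)
      Real.measurableSpace] (E k) := ⟨Ici (s * logScale k), measurableSet_Ici, rfl⟩
    refine (condExp_indep_eq (hmeas k).comap_le (ℋ.le k)
      (stronglyMeasurable_one.indicator hE) hind).trans ?_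
    rw [integral_indicator_one ((hmeas k).comap_le _ hE)]
  obtain ⟨c, hc, hlow⟩ : ∃ c > 0, ∀ᶠ i : ℕ in atTop, c * (i : ℝ)⁻¹ ≤ P.real (E i) := by
    obtain ⟨c, hc, hlow⟩ := le_measure_logScale_le_of_gaussianReal (hmeas 0)
      (hξ.map_autoregressive q _ m) hs hsv
    refine ⟨c, hc, ?_⟩
    filter_upwards [hlow] with i hi
    have h1 : P (E i) = P {ω | s * logScale i ≤ autoregressive q ξ (0 * m) m ω} := by
      have h2 : ∀ l, P {ω | s * logScale i ≤ autoregressive q ξ l m ω} =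
          gaussianReal 0 (autoregressiveVar q u m) (Ici (s * logScale i)) := fun l => by
        rw [← hξ.map_autoregressive q l m, Measure.map_apply
          ((hξ.measurable_autoregressive q l m).mono (G.le _) le_rfl) measurableSet_Ici]
        rfl
      exact (h2 _).trans (h2 _).symm
    rw [← h1] at hi
    exact (ENNReal.ofReal_le_iff_le_toReal (measure_ne_top P _)).1 hi
  have hdiv : Tendsto (fun n => ∑ k ∈ Finset.range n, P.real (E k)) atTop atTop := by
    rw [← not_summable_iff_tendsto_nat_atTop_of_nonneg fun _ => measureReal_nonneg]
    intro hsum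
    refine not_summable_natCast_inv ((summable_mul_left_iff hc.ne').1
      (hsum.of_norm_bounded_eventually_nat ?_))
    filter_upwards [hlow] with i hi
    rwa [norm_of_nonneg (by positivity)]
  filter_upwards [ae_mem_limsup_atTop_iff P hS, ae_all_iff.2 hcond] with ω h1 h2
  have h3 := h1.2 (by simpa only [h2] using hdiv)
  rw [mem_limsup_iff_frequently_mem] at h3
  rw [← map_add_atTop_eq_nat 1, frequently_map] at h3
  exact h3

end IsGaussianInnovation

theorem hasDerivAt_integral_of_continuousOn_Ici {f : ℝ → ℝ} (hf : ContinuousOn f (Ici 0)) {t : ℝ}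
    (ht : 0 < t) : HasDerivAt (fun s => ∫ u in (0 : ℝ)..s, f u) (f t) t := by
  refine intervalIntegral.integral_hasDerivAt_right ?_ ?_ (hf.continuousAt (Ici_mem_nhds ht))
  · refine (hf.mono fun s hs => ?_).intervalIntegrable
    rw [uIcc_of_le ht.le] at hs
    exact hs.1
  · exact (hf.mono Ioi_subset_Ici_self).stronglyMeasurableAtFilter isOpen_Ioi t ht

theorem continuousOn_integral_of_continuousOn_Ici {f : ℝ → ℝ} (hf : ContinuousOn f (Ici 0)) :
    ContinuousOn (fun s => ∫ u in (0 : ℝ)..s, f u) (Ici 0) := by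
  have hg : Continuous fun s => f (max s 0) :=
    hf.comp_continuous (by fun_prop) fun s => le_max_right s 0
  refine (intervalIntegral.continuous_primitive (μ := volume)
    (fun _ _ => hg.intervalIntegrable _ _) 0).continuousOn.congr fun s hs => ?_
  refine intervalIntegral.integral_congr fun u hu => ?_
  rw [uIcc_of_le (show (0 : ℝ) ≤ s from hs)] at hu
  simp only [max_eq_left hu.1]

/-- The deterministic hypotheses of `path_bounds` hold for the integral equation. -/
theorem path_bounds_of_integral_eq {x β : ℝ → ℝ} {a b h η A r e δ c I : ℝ} {v : ℕ → ℝ} {m : ℕ}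
    (ha : a < 0) (hab : a + b ≤ 0) (h0 : 0 < h) (hah : |a| * h ≤ 1) (hη : 0 ≤ η) (hA : 0 ≤ A)
    (hr : 0 ≤ r) (hδ : 0 < δ) (hm : 0 < m) (hc : 0 ≤ e - exp (a * h) ^ m * r - 2 * η)
    (hx : ContinuousOn x (Ici 0)) (hβ : Continuous β)
    (heq : ∀ t : ℝ, 0 ≤ t → x t = c + (∫ s in (0 : ℝ)..t,
      (a * x s + b / (1 + s) * (I + ∫ u in (0 : ℝ)..s, x u))) + β t)
    (hv : ∀ k : ℕ, v (k + 1) = exp (a * h) * v k + (β ((k + 1 : ℕ) * h) - β (k * h)))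
    (hosc : ∀ᶠ k : ℕ in atTop, ∀ t ∈ Icc ((k : ℝ) * h) (k * h + h),
      |β t - β (k * h)| ≤ η * logScale k)
    (hgrow : ∀ᶠ k : ℕ in atTop, |β (k * h)| ≤ A * (√k * logScale k))
    (hupper : ∀ᶠ k : ℕ in atTop, |v k| ≤ r * logScale k)
    (hlower : ∃ᶠ i : ℕ in atTop,
      e * logScale i ≤ v ((i + 1) * m) - exp (a * h) ^ m * v (i * m)) :
    (∀ᶠ t in atTop, |x t| ≤ (r + 4 * η + δ) * logScale t) ∧
      ∃ᶠ t in atTop, (e - exp (a * h) ^ m * r - 2 * η - δ) * logScale t ≤ x t := by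
  have hg : ContinuousOn (fun s => a * x s + b / (1 + s) * (I + ∫ u in (0 : ℝ)..s, x u))
      (Ici 0) := by
    refine (hx.const_mul a).add ((continuousOn_const.div (by fun_prop) fun s hs => ?_).mul
      ((continuousOn_integral_of_continuousOn_Ici hx).const_add I))
    have : (0 : ℝ) ≤ s := hs
    positivity
  refine path_bounds (x := x) (β := β) (w := fun t => x t - β t)
    (J := fun s => I + ∫ u in (0 : ℝ)..s, x u)
    (p := fun t => a * (exp (a * t) * ∫ s in (0 : ℝ)..t, exp (-(a * s)) * β s))
    ha hab h0 hah hη hA hr hδ hm hc (fun t _ => by ring) (fun t ht => ?_)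
    (fun t ht => (hasDerivAt_integral_of_continuousOn_Ici hx ht).const_add I) (fun t => ?_)
    hv hosc hgrow hupper hlower
  · refine ((hasDerivAt_integral_of_continuousOn_Ici hg ht).const_add c).congr_of_eventuallyEq ?_
    filter_upwards [lt_mem_nhds ht] with s hs
    rw [heq s hs.le]
    ring
  · have h1 : Continuous fun s => exp (-(a * s)) * β s := by fun_prop
    have h2 := (h1.integral_hasStrictDerivAt 0 t).hasDerivAt
    have h3 : HasDerivAt (fun t => exp (a * t)) (exp (a * t) * (a * 1)) t :=
      ((hasDerivAt_id t).const_mul a).exp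
    refine ((h3.mul h2).const_mul a).congr_deriv ?_
    have h4 : exp (a * t) * exp (-(a * t)) = 1 := by rw [← exp_add]; simp
    linear_combination a * β t * h4

section Brownian

variable {Ω : Type*} {mΩ : MeasurableSpace Ω} {P : Measure Ω}
  {F : MeasureTheory.Filtration ℝ mΩ} {B : ℝ → Ω → ℝ}

/-- The filtration `F` sampled along the grid of mesh `h`. -/
def gridFiltration (F : MeasureTheory.Filtration ℝ mΩ) {h : ℝ} (h0 : 0 ≤ h) :
    MeasureTheory.Filtration ℕ mΩ where
  seq k := F (k * h)
  mono' i j hij := F.mono (by gcongr)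
  le' k := F.le _

theorem IsStdBrownian.isGaussianInnovation (hB : IsStdBrownian P F B) {h : ℝ} (h0 : 0 ≤ h)
    (σ : ℝ) :
    IsGaussianInnovation P (gridFiltration F h0) (.mk (σ ^ 2) (sq_nonneg σ) * h.toNNReal)
      fun k ω => σ * (B ((k + 1 : ℕ) * h) ω - B (k * h) ω) where
  measurable_succ i := by
    have h1 : (i : ℝ) * h ≤ (i + 1 : ℕ) * h := by
      push_cast
      nlinarith
    exact ((hB.1 _).sub ((hB.1 _).mono (F.mono h1) le_rfl)).const_mul σ
  map_eq i := by
    have h1 := hB.2.2.2.1 (i * h) ((i + 1 : ℕ) * h) (by positivity) (by push_cast; nlinarith)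
    rw [show ((i + 1 : ℕ) : ℝ) * h - i * h = h by push_cast; ring] at h1
    have h2 := gaussianReal_map_const_mul (μ := 0) (v := h.toNNReal) σ
    have hm : Measurable fun ω => B ((i + 1 : ℕ) * h) ω - B (i * h) ω :=
      (hB.measurable _).sub (hB.measurable _)
    rw [← h1, Measure.map_map (by fun_prop) hm, mul_zero] at h2
    exact h2
  indep i := by
    have h1 := hB.2.2.2.2 (i * h) ((i + 1 : ℕ) * h) (by positivity) (by push_cast; nlinarith)
    refine indep_of_indep_of_le_left h1 ?_
    have h2 : Measurable[MeasurableSpace.comap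
        (fun ω => B ((i + 1 : ℕ) * h) ω - B (i * h) ω) Real.measurableSpace]
        (fun ω => σ * (B ((i + 1 : ℕ) * h) ω - B (i * h) ω)) :=
      (comap_measurable _).const_mul σ
    exact h2.comap_le

end Brownian

/-- Two-sided bounds for the stationary variance of the sampled Ornstein-Uhlenbeck process. -/
theorem sampled_variance_bounds {a h σ : ℝ} (ha : a < 0) :
    (σ / √(2 * |a|)) ^ 2 * (1 - exp (a * h) ^ 2) ≤ σ ^ 2 * h ∧
      σ ^ 2 * h ≤ (σ / √(2 * |a|)) ^ 2 * (1 + 2 * |a| * h) * (1 - exp (a * h) ^ 2) := by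
  have ha' : 0 < |a| := abs_pos.2 ha.ne
  have hq : exp (a * h) ^ 2 = exp (-(2 * |a| * h)) := by
    rw [← exp_nat_mul, abs_of_neg ha]
    congr 1
    push_cast
    ring
  have hsq : (σ / √(2 * |a|)) ^ 2 * (2 * |a|) = σ ^ 2 := by
    rw [div_pow, sq_sqrt (by positivity)]
    field_simp
  have h1 := add_one_le_exp (-(2 * |a| * h))
  have h2 : exp (-(2 * |a| * h)) * (1 + 2 * |a| * h) ≤ 1 := by
    calc _ ≤ exp (-(2 * |a| * h)) * exp (2 * |a| * h) := by
          gcongr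
          linarith [add_one_le_exp (2 * |a| * h)]
      _ = 1 := by rw [← exp_add]; simp
  have h3 := sq_nonneg (σ / √(2 * |a|))
  rw [hq, ← hsq]
  constructor <;> nlinarith

theorem exists_mesh {a σ ρ δ : ℝ} (hδ : 0 < δ) :
    ∃ h > 0, 2 * |a| * h ≤ 1 ∧ ρ * (2 * |a| * h) ≤ δ / 4 ∧ 4 * (σ * √(128 * h)) ≤ δ / 4 := by
  have h1 : ∀ᶠ h : ℝ in nhds 0, 2 * |a| * h < 1 ∧ ρ * (2 * |a| * h) < δ / 4 ∧
      4 * (σ * √(128 * h)) < δ / 4 := by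
    refine ((Continuous.tendsto (by fun_prop) 0).eventually_lt_const ?_).and
      (((Continuous.tendsto (by fun_prop) 0).eventually_lt_const ?_).and
      ((Continuous.tendsto (by fun_prop) 0).eventually_lt_const ?_)) <;> simp [hδ]
  obtain ⟨h, h2, h3⟩ := ((h1.filter_mono nhdsWithin_le_nhds).and
    (self_mem_nhdsWithin : Ioi (0 : ℝ) ∈ nhdsWithin 0 (Ioi 0))).exists
  exact ⟨h, h3, h2.1.le, h2.2.1.le, h2.2.2.le⟩

theorem IsSolutionSFDE.ae_bounds {Ω : Type*} {mΩ : MeasurableSpace Ω} {P : Measure Ω}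
    [IsProbabilityMeasure P] {F : MeasureTheory.Filtration ℝ mΩ} {a b σ : ℝ} {ψ : ℝ → ℝ}
    {B X : ℝ → Ω → ℝ} (hX : IsSolutionSFDE P F a b σ ψ B X) (hB : IsStdBrownian P F B)
    (hσ : 0 < σ) (ha : a < 0) (hab : a + b ≤ 0) {δ : ℝ} (hδ : 0 < δ)
    (hδρ : δ ≤ σ / √(2 * |a|)) :
    ∀ᵐ ω ∂P, (∀ᶠ t in atTop, |X t ω| ≤ (σ / √(2 * |a|) + δ) * logScale t) ∧
      ∃ᶠ t in atTop, (σ / √(2 * |a|) - δ) * logScale t ≤ X t ω := by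
  set ρ := σ / √(2 * |a|) with hρ
  have ha' : 0 < |a| := abs_pos.2 ha.ne
  have hρ0 : 0 < ρ := by positivity
  obtain ⟨h, h0, hah, hρh, hση⟩ := exists_mesh (a := a) (σ := σ) (ρ := ρ) hδ
  set q := exp (a * h) with hq
  have hq0 : 0 < q := exp_pos _
  have hq1 : q < 1 := exp_lt_one_iff.2 (mul_neg_of_neg_of_pos ha h0)
  obtain ⟨m, hm0, hm⟩ : ∃ m : ℕ, 0 < m ∧ q ^ m * (3 * ρ) < δ / 4 := by
    have h1 := (tendsto_pow_atTop_nhds_zero_of_lt_one hq0.le hq1).mul_const (3 * ρ)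
    rw [zero_mul] at h1
    exact ((eventually_gt_atTop 0).and (h1.eventually_lt_const (by positivity))).exists
  set y := 2 * |a| * h with hy
  have hy0 : 0 < y := by positivity
  set η := σ * √(128 * h) with hη
  have hη0 : 0 ≤ η := by positivity
  obtain ⟨hvar1, hvar2⟩ := sampled_variance_bounds (h := h) (σ := σ) ha
  rw [← hρ, ← hq, ← hy] at hvar2
  rw [← hρ, ← hq] at hvar1
  have hqq : 0 < 1 - q ^ 2 := by nlinarith
  have hqm0 : 0 < q ^ m := by positivity
  have hqm1 : q ^ m < 1 := pow_lt_one₀ hq0.le hq1 hm0.ne'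
  have hinn := hB.isGaussianInnovation h0.le σ
  set u : NNReal := .mk (σ ^ 2) (sq_nonneg σ) * h.toNNReal with hu
  have hu' : (u : ℝ) = σ ^ 2 * h := by simp [hu, h0.le]
  have hcoe := coe_autoregressiveVar q u
  rw [hu'] at hcoe
  have hup := hinn.ae_autoregressive_le (q := q) (r := ρ * (1 + y)) (γ := 1 + y)
    (w := (ρ ^ 2 * (1 + y)).toNNReal) (by positivity) (fun j => ?_) (by positivity) (by linarith)
    (by rw [Real.coe_toNNReal _ (by positivity)]; linarith)
  swap
  · rw [← NNReal.coe_le_coe, Real.coe_toNNReal _ (by positivity)]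
    refine le_of_mul_le_mul_left ?_ hqq
    have : 0 ≤ σ ^ 2 * h * (q ^ 2) ^ j := by positivity
    rw [hcoe j]
    linarith
  have hlow := hinn.ae_frequently_le_autoregressive (q := q) (s := ρ * (1 - q ^ m)) (m := m)
    (mul_nonneg hρ0.le (by linarith)) ?_
  swap
  · refine lt_of_mul_lt_mul_left ?_ hqq.le
    rw [hcoe m, ← pow_mul, mul_comm 2 m, pow_mul]
    have h1 : (1 - q ^ m) ^ 2 < 1 - (q ^ m) ^ 2 := by nlinarith
    calc (1 - q ^ 2) * (ρ * (1 - q ^ m)) ^ 2 = ρ ^ 2 * (1 - q ^ 2) * (1 - q ^ m) ^ 2 := by ring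
      _ < ρ ^ 2 * (1 - q ^ 2) * (1 - (q ^ m) ^ 2) := by gcongr
      _ ≤ _ := by
        gcongr
        exact (sq_nonneg _).trans h1.le
  have hc : 0 ≤ ρ * (1 - q ^ m) - q ^ m * (ρ * (1 + y)) - 2 * η ∧
      ρ - δ ≤ ρ * (1 - q ^ m) - q ^ m * (ρ * (1 + y)) - 2 * η - δ / 4 := by
    have : q ^ m * (ρ * y) ≤ q ^ m * ρ := by
      gcongr
      nlinarith
    constructor <;> linarith
  filter_upwards [hX.2.2, hup, hlow, hB.ae_grid_growth h0,
    hB.ae_oscillation_le h0 (sqrt_nonneg (128 * h)) (sq_sqrt (by positivity)).ge]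
    with ω hsol hupω hlowω hgrow hosc
  have hosc' : ∀ᶠ k : ℕ in atTop, ∀ t ∈ Icc ((k : ℝ) * h) (k * h + h),
      |σ * B t ω - σ * B (k * h) ω| ≤ η * logScale k := by
    filter_upwards [hosc] with k hk t ht
    rw [← mul_sub, abs_mul, abs_of_pos hσ, hη, mul_assoc]
    exact mul_le_mul_of_nonneg_left (hk t ht) hσ.le
  have hgrow' : ∀ᶠ k : ℕ in atTop,
      |σ * B (k * h) ω| ≤ σ * √(2 * h) * (√k * logScale k) := by
    filter_upwards [hgrow] with k hk
    rw [abs_mul, abs_of_pos hσ, mul_assoc]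
    exact mul_le_mul_of_nonneg_left hk hσ.le
  set v : ℕ → ℝ := fun k => autoregressive q
    (fun k ω => σ * (B ((k + 1 : ℕ) * h) ω - B (k * h) ω)) 0 k ω with hv
  have hlow' : ∃ᶠ i : ℕ in atTop,
      ρ * (1 - q ^ m) * logScale i ≤ v ((i + 1) * m) - q ^ m * v (i * m) := by
    refine hlowω.mono fun i hi => ?_
    simp only [hv, add_one_mul i m, autoregressive_zero_add]
    linarith
  obtain ⟨h1, h2⟩ := path_bounds_of_integral_eq (δ := δ / 4) ha hab h0 (by linarith) hη0
    (by positivity) (by positivity) (by positivity) hm0 hc.1 (hX.2.1 ω)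
    ((hB.2.2.1 ω).const_mul σ) hsol
    (fun k => by simp only [autoregressive, zero_add]; ring) hosc' hgrow' hupω hlow'
  constructor
  · filter_upwards [h1] with t ht
    refine ht.trans (mul_le_mul_of_nonneg_right ?_ (logScale_nonneg t))
    linarith
  · exact h2.mono fun t ht => (mul_le_mul_of_nonneg_right hc.2 (logScale_nonneg t)).trans ht

theorem IsStdBrownian.neg {Ω : Type*} {mΩ : MeasurableSpace Ω} {P : Measure Ω}
    {F : MeasureTheory.Filtration ℝ mΩ} {B : ℝ → Ω → ℝ} (hB : IsStdBrownian P F B) :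
    IsStdBrownian P F fun t ω => -B t ω := by
  have hincr : ∀ s t, (fun ω => -B t ω - -B s ω) = fun ω => -(B t ω - B s ω) := fun s t => by
    ext ω
    ring
  refine ⟨fun t => (hB.1 t).neg, fun ω => by simp [hB.2.1 ω], fun ω => (hB.2.2.1 ω).neg,
    fun s t hs hst => ?_, fun s t hs hst => ?_⟩
  · have hm : Measurable fun ω => B t ω - B s ω := (hB.measurable t).sub (hB.measurable s)
    have h1 := gaussianReal_map_neg (μ := 0) (v := (t - s).toNNReal)
    rw [← hB.2.2.2.1 s t hs hst, Measure.map_map measurable_neg hm, neg_zero] at h1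
    rw [hincr]
    exact h1
  · have h1 : Measurable[MeasurableSpace.comap (fun ω => B t ω - B s ω) Real.measurableSpace]
        (fun ω => -(B t ω - B s ω)) := (comap_measurable _).neg
    rw [hincr]
    exact indep_of_indep_of_le_left (hB.2.2.2.2 s t hs hst) h1.comap_le

theorem IsSolutionSFDE.neg {Ω : Type*} {mΩ : MeasurableSpace Ω} {P : Measure Ω}
    {F : MeasureTheory.Filtration ℝ mΩ} {a b σ : ℝ} {ψ : ℝ → ℝ} {B X : ℝ → Ω → ℝ}
    (hX : IsSolutionSFDE P F a b σ ψ B X) :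
    IsSolutionSFDE P F a b σ (fun t => -ψ t) (fun t ω => -B t ω) fun t ω => -X t ω := by
  refine ⟨fun t ht => (hX.1 t ht).neg, fun ω => (hX.2.1 ω).neg, ?_⟩
  filter_upwards [hX.2.2] with ω hω t ht
  rw [hω t ht]
  have h1 : ∀ s, a * -X s ω + b / (1 + s) * ((∫ u in (-1 : ℝ)..0, -ψ u) +
      ∫ u in (0 : ℝ)..s, -X u ω) = -(a * X s ω + b / (1 + s) * ((∫ u in (-1 : ℝ)..0, ψ u) +
      ∫ u in (0 : ℝ)..s, X u ω)) := fun s => by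
    rw [intervalIntegral.integral_neg, intervalIntegral.integral_neg]
    ring
  simp_rw [h1]
  rw [intervalIntegral.integral_neg]
  ring

theorem limsup_eq_of_tendsto_bounds {g : ℝ → ℝ} {ρ : ℝ} {d : ℕ → ℝ}
    (hd : Tendsto d atTop (nhds 0)) (hup : ∀ n, ∀ᶠ t in atTop, |g t| ≤ ρ + d n)
    (hlow : ∀ n, ∃ᶠ t in atTop, ρ - d n ≤ g t) : limsup g atTop = ρ := by
  have hbdd : IsBoundedUnder (· ≤ ·) atTop g :=
    isBoundedUnder_of_eventually_le ((hup 0).mono fun t ht => (abs_le.1 ht).2)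
  have hbdd' : IsBoundedUnder (· ≥ ·) atTop g :=
    isBoundedUnder_of_eventually_ge ((hup 0).mono fun t ht => (abs_le.1 ht).1)
  refine le_antisymm (ge_of_tendsto' (by simpa using hd.const_add ρ) fun n => ?_)
    (le_of_tendsto' (by simpa using hd.const_sub ρ) fun n => ?_)
  · exact limsup_le_of_le hbdd'.isCoboundedUnder_le ((hup n).mono fun t ht => (abs_le.1 ht).2)
  · exact le_limsup_of_frequently_le (hlow n) hbdd

theorem liminf_eq_of_tendsto_bounds {g : ℝ → ℝ} {ρ : ℝ} {d : ℕ → ℝ}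
    (hd : Tendsto d atTop (nhds 0)) (hup : ∀ n, ∀ᶠ t in atTop, |g t| ≤ ρ + d n)
    (hlow : ∀ n, ∃ᶠ t in atTop, ρ - d n ≤ -g t) : liminf g atTop = -ρ := by
  have hbdd : IsBoundedUnder (· ≤ ·) atTop g :=
    isBoundedUnder_of_eventually_le ((hup 0).mono fun t ht => (abs_le.1 ht).2)
  have hbdd' : IsBoundedUnder (· ≥ ·) atTop g :=
    isBoundedUnder_of_eventually_ge ((hup 0).mono fun t ht => (abs_le.1 ht).1)
  refine le_antisymm (ge_of_tendsto' (by simpa using hd.const_add (-ρ)) fun n => ?_)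
    (le_of_tendsto' (by simpa using hd.const_sub (-ρ)) fun n => ?_)
  · exact liminf_le_of_frequently_le ((hlow n).mono fun t ht => by linarith) hbdd'
  · exact le_liminf_of_le hbdd.isCoboundedUnder_ge
      ((hup n).mono fun t ht => by linarith [(abs_le.1 ht).1])

/-- `IsSolutionSFDE.ae_bounds` along a sequence of tolerances, for the rescaled solution. -/
theorem IsSolutionSFDE.ae_scaled_bounds {Ω : Type*} {mΩ : MeasurableSpace Ω} {P : Measure Ω}
    [IsProbabilityMeasure P] {F : MeasureTheory.Filtration ℝ mΩ} {a b σ : ℝ} {ψ : ℝ → ℝ}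
    {B X : ℝ → Ω → ℝ} (hX : IsSolutionSFDE P F a b σ ψ B X) (hB : IsStdBrownian P F B)
    (hσ : 0 < σ) (ha : a < 0) (hab : a + b ≤ 0) :
    ∀ᵐ ω ∂P, ∀ n : ℕ,
      (∀ᶠ t in atTop, |X t ω / logScale t| ≤
        σ / √(2 * |a|) + σ / √(2 * |a|) / (n + 1)) ∧
      ∃ᶠ t in atTop, σ / √(2 * |a|) - σ / √(2 * |a|) / (n + 1) ≤ X t ω / logScale t := by
  have ha' : 0 < |a| := abs_pos.2 ha.ne
  refine ae_all_iff.2 fun n => ?_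
  filter_upwards [hX.ae_bounds hB hσ ha hab (δ := σ / √(2 * |a|) / (n + 1)) (by positivity)
    (div_le_self (by positivity) (by linarith [n.cast_nonneg (α := ℝ)]))] with ω ⟨h1, h2⟩
  have hpos := tendsto_logScale.eventually_gt_atTop 0
  constructor
  · filter_upwards [h1, hpos] with t h3 h4
    rwa [abs_div, abs_of_pos h4, div_le_iff₀ h4]
  · refine (h2.and_eventually hpos).mono fun t ht => ?_
    rw [le_div_iff₀ ht.2]
    exact ht.1

theorem sfde_limsup_liminf_log {Ω : Type*} {mΩ : MeasurableSpace Ω} (P : Measure Ω) [IsProbabilityMeasure P]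
    (F : MeasureTheory.Filtration ℝ mΩ) (a b σ : ℝ) (ψ : ℝ → ℝ) (B X : ℝ → Ω → ℝ)
    (hσ : 0 < σ) (hψ : ContinuousOn ψ (Set.Icc (-1 : ℝ) 0))
    (hB : IsStdBrownian P F B) (hX : IsSolutionSFDE P F a b σ ψ B X)
    (ha : a < 0) (hab : a + b ≤ 0) :
    ∀ᵐ ω ∂P,
      Filter.limsup (fun t : ℝ => X t ω / Real.sqrt (2 * Real.log t)) Filter.atTop
        = σ / Real.sqrt (2 * |a|) ∧
      Filter.liminf (fun t : ℝ => X t ω / Real.sqrt (2 * Real.log t)) Filter.atTop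
        = -(σ / Real.sqrt (2 * |a|)) := by
  filter_upwards [hX.ae_scaled_bounds hB hσ ha hab, hX.neg.ae_scaled_bounds hB.neg hσ ha hab]
    with ω h1 h2
  have hd : Tendsto (fun n : ℕ => σ / √(2 * |a|) / ((n : ℝ) + 1)) atTop (nhds 0) :=
    (tendsto_atTop_add_const_right _ _ tendsto_natCast_atTop_atTop).const_div_atTop _
  exact ⟨limsup_eq_of_tendsto_bounds hd (fun n => (h1 n).1) fun n => (h1 n).2,
    liminf_eq_of_tendsto_bounds hd (fun n => (h1 n).1) fun n =>
      (h2 n).2.mono fun t ht => by rwa [neg_div] at ht⟩
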